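/- There exists Θ₀ ∈ (0,∞) such that: (1) for all Θ ∈ (0,Θ₀) one has m_Θ < 2π·m̂_{Θ/√(2π)}, and every minimizer (u,v) of m_Θ (i.e. (u,v) ∈ V_Θ with I(u,v) = m_Θ) satisfies (u_y, v_y) ≠ (0,0), i.e. it is not independent of the y-variable; (2) for all Θ ∈ (Θ₀,∞) one has m_Θ = 2π·m̂_{Θ/√(2π)}, and every minimizer (u,v) of m_Θ satisfies u_y = 0 and v_y = 0, i.e. it is independent of the y-variable. -/

import Mathlib

noncomputable section

open MeasureTheory Real Filter

namespace Waveguide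

/-- A point of the waveguide `ℝ³ × 𝕋`, modelled as `ℝ³ × ℝ` with functions that are
`2π`-periodic in the second coordinate. -/
abbrev Pt : Type := (Fin 3 → ℝ) × ℝ

/-- The fundamental domain `ℝ³ × (0, 2π]` of the waveguide `ℝ³ × 𝕋`. -/
def Dom : Set Pt := Set.univ ×ˢ Set.Ioc 0 (2 * π)

/-- `2π`-periodicity in the `y` variable. -/
def PeriodicY (u : Pt → ℝ) : Prop := ∀ x y, u (x, y + 2 * π) = u (x, y)

/-- The `i`-th horizontal coordinate direction. -/
def ex (i : Fin 3) : Pt := (fun j => if j = i then 1 else 0, 0)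

/-- The vertical (periodic) direction. -/
def ey : Pt := (0, 1)

/-- `i`-th partial derivative in the `x` variables. -/
def gradx (u : Pt → ℝ) (p : Pt) (i : Fin 3) : ℝ := fderiv ℝ u p (ex i)

/-- Partial derivative in the `y` variable, `u_y`. -/
def grady (u : Pt → ℝ) (p : Pt) : ℝ := fderiv ℝ u p ey

/-- `|∇_x u|²`. -/
def gradSqX (u : Pt → ℝ) (p : Pt) : ℝ := ∑ i, (gradx u p i) ^ 2

/-- `|∇_{x,y} u|²`. -/
def gradSq (u : Pt → ℝ) (p : Pt) : ℝ := gradSqX u p + (grady u p) ^ 2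

/-- Membership in (a regular repesentative of) `H¹(ℝ³ × 𝕋)`, for real valued functions. -/
structure H1 (u : Pt → ℝ) : Prop where
  periodic : PeriodicY u
  diff : Differentiable ℝ u
  memL2 : IntegrableOn (fun p => (u p) ^ 2) Dom
  memGrad : IntegrableOn (fun p => gradSq u p) Dom
  memL4 : IntegrableOn (fun p => (u p) ^ 4) Dom

/-- The `L²(ℝ³ × 𝕋)` norm. -/
def l2 (u : Pt → ℝ) : ℝ := Real.sqrt (∫ p in Dom, (u p) ^ 2)

/-- `u ∈ S_Θ`. -/
def inS (Θ : ℝ) (u : Pt → ℝ) : Prop := H1 u ∧ l2 u = Θ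

/-- The nonlinear density `u⁴ + 2u²v² + v⁴`. -/
def nonlin (u v : Pt → ℝ) (p : Pt) : ℝ :=
  (u p) ^ 4 + 2 * (u p) ^ 2 * (v p) ^ 2 + (v p) ^ 4

/-- The energy functional `I(u,v)`. -/
def energy (u v : Pt → ℝ) : ℝ :=
  (1 / 2) * (∫ p in Dom, (gradSq u p + gradSq v p))
    - (1 / 4) * ∫ p in Dom, nonlin u v p

/-- The semivirial functional `Q(u,v)`. -/
def svirial (u v : Pt → ℝ) : ℝ :=
  (∫ p in Dom, (gradSqX u p + gradSqX v p))
    - (3 / 4) * ∫ p in Dom, nonlin u v p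

/-- The ground-state level `m_Θ`. -/
def mlevel (Θ : ℝ) : ℝ :=
  sInf {c | ∃ u v : Pt → ℝ, inS Θ u ∧ inS Θ v ∧ svirial u v = 0 ∧ energy u v = c}

/-- `(u,v)` is a minimizer of `m_Θ`: it lies in `V_Θ` and attains the infimum. -/
def isMinimizer (Θ : ℝ) (u v : Pt → ℝ) : Prop :=
  inS Θ u ∧ inS Θ v ∧ svirial u v = 0 ∧ energy u v = mlevel Θ

/-- Smooth, compactly supported (in `x`) test function on the waveguide. -/
def TestFun (φ : Pt → ℝ) : Prop :=
  ContDiff ℝ (⊤ : ℕ∞) φ ∧ PeriodicY φ ∧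
    ∃ K : Set (Fin 3 → ℝ), IsCompact K ∧ ∀ p : Pt, p.1 ∉ K → φ p = 0

/-- `u` is a weak solution of `-Δ_{x,y} u + lam u = f` on `ℝ³ × 𝕋`. -/
def WeakSol (lam : ℝ) (u f : Pt → ℝ) : Prop :=
  ∀ φ : Pt → ℝ, TestFun φ →
    (∫ p in Dom,
        ((∑ i, gradx u p i * gradx φ p i) + grady u p * grady φ p + lam * u p * φ p))
      = ∫ p in Dom, f p * φ p

/-- The mass-preserving rescaling `u^τ(x,y) = τ^{3/2} u(τx, y)`. -/
def scaleX (τ : ℝ) (u : Pt → ℝ) : Pt → ℝ :=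
  fun p => τ ^ ((3 : ℝ) / 2) * u (τ • p.1, p.2)

/-- `u` is independent of the `y` variable, i.e. `u_y = 0` (a.e.). -/
def Yindep (u : Pt → ℝ) : Prop := ∀ᵐ p : Pt ∂volume, grady u p = 0

/-- The functional `J_μ(u,v)`. -/
def Jfun (μ : ℝ) (u v : Pt → ℝ) : ℝ :=
  (1 / 2) * (∫ p in Dom,
      (gradSqX u p + μ * (grady u p) ^ 2 + gradSqX v p + μ * (grady v p) ^ 2))
    - (1 / 4) * ∫ p in Dom, nonlin u v p

/-- The level `m_{1,μ}`. -/
def m1 (μ : ℝ) : ℝ :=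
  sInf {c | ∃ u v : Pt → ℝ, inS 1 u ∧ inS 1 v ∧ svirial u v = 0 ∧ Jfun μ u v = c}

/-- `(u,v)` is a minimizer of `m_{1,μ}`. -/
def isMinimizerJ (μ : ℝ) (u v : Pt → ℝ) : Prop :=
  inS 1 u ∧ inS 1 v ∧ svirial u v = 0 ∧ Jfun μ u v = m1 μ

/-! ### Objects on `ℝ³` -/

abbrev Pt3 : Type := Fin 3 → ℝ

def e3 (i : Fin 3) : Pt3 := fun j => if j = i then 1 else 0

def grad3 (w : Pt3 → ℝ) (x : Pt3) (i : Fin 3) : ℝ := fderiv ℝ w x (e3 i)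

def gradSq3 (w : Pt3 → ℝ) (x : Pt3) : ℝ := ∑ i, (grad3 w x i) ^ 2

/-- Membership in (a regular representative of) `H¹(ℝ³)`. -/
structure H1R3 (w : Pt3 → ℝ) : Prop where
  diff : Differentiable ℝ w
  memL2 : Integrable (fun x => (w x) ^ 2)
  memGrad : Integrable (fun x => gradSq3 w x)
  memL4 : Integrable (fun x => (w x) ^ 4)

/-- The `L²(ℝ³)` norm. -/
def l2R3 (w : Pt3 → ℝ) : ℝ := Real.sqrt (∫ x, (w x) ^ 2)

def nonlin3 (u v : Pt3 → ℝ) (x : Pt3) : ℝ :=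
  (u x) ^ 4 + 2 * (u x) ^ 2 * (v x) ^ 2 + (v x) ^ 4

/-- The limit energy `Î(u,v)` on `ℝ³`. -/
def Ihat (u v : Pt3 → ℝ) : ℝ :=
  (1 / 2) * (∫ x, (gradSq3 u x + gradSq3 v x)) - (1 / 4) * ∫ x, nonlin3 u v x

/-- The virial `Q̂(u,v)` on `ℝ³`. -/
def Qhat (u v : Pt3 → ℝ) : ℝ :=
  (∫ x, (gradSq3 u x + gradSq3 v x)) - (3 / 4) * ∫ x, nonlin3 u v x

/-- The ground-state energy `m̂_ρ` on `ℝ³`. -/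
def mhat (ρ : ℝ) : ℝ :=
  sInf {c | ∃ u v : Pt3 → ℝ, H1R3 u ∧ H1R3 v ∧ l2R3 u = ρ ∧ l2R3 v = ρ ∧
    Qhat u v = 0 ∧ Ihat u v = c}


section General

variable {α : Type*} [MeasurableSpace α] {μ : Measure α}

lemma enorm_sq_eq (a : ℝ) : ‖a‖ₑ ^ 2 = ENNReal.ofReal (a ^ 2) := by
  rw [Real.enorm_eq_ofReal_abs, ← ENNReal.ofReal_pow (abs_nonneg _), sq_abs]

lemma lintegral_enorm_sq_eq {f : α → ℝ} (hf : MemLp f 2 μ) :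
    ∫⁻ x, ‖f x‖ₑ ^ 2 ∂μ = ENNReal.ofReal (∫ x, f x ^ 2 ∂μ) := by
  rw [ofReal_integral_eq_lintegral_ofReal hf.integrable_sq (ae_of_all _ fun x => sq_nonneg _)]
  simp only [enorm_sq_eq]

lemma memLp_two_of_lintegral_lt_top {f : α → ℝ} (hf : AEStronglyMeasurable f μ)
    (h : ∫⁻ x, ‖f x‖ₑ ^ 2 ∂μ < ⊤) : MemLp f 2 μ := by
  refine ⟨hf, ?_⟩
  rw [eLpNorm_lt_top_iff_lintegral_rpow_enorm_lt_top (by norm_num) (by norm_num)]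
  simpa using h

lemma integral_sq_le_of_lintegral_le {f : α → ℝ} (hf : MemLp f 2 μ) {c : ℝ} (hc : 0 ≤ c)
    (h : ∫⁻ x, ‖f x‖ₑ ^ 2 ∂μ ≤ ENNReal.ofReal c) : ∫ x, f x ^ 2 ∂μ ≤ c := by
  rw [lintegral_enorm_sq_eq hf] at h
  exact (ENNReal.ofReal_le_ofReal_iff hc).1 h

lemma lintegral_mul_sq_le {f g : α → ENNReal} (hf : AEMeasurable f μ) (hg : AEMeasurable g μ) :
    (∫⁻ x, f x * g x ∂μ) ^ 2 ≤ (∫⁻ x, f x ^ 2 ∂μ) * ∫⁻ x, g x ^ 2 ∂μ := by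
  have := ENNReal.lintegral_mul_norm_pow_le (hf.pow_const 2) (hg.pow_const 2)
    (p := 1 / 2) (q := 1 / 2) (by norm_num) (by norm_num) (by norm_num)
  have e : ∀ a : ENNReal, (a ^ 2) ^ (1 / 2 : ℝ) = a := fun a => by
    rw [← ENNReal.rpow_natCast, ← ENNReal.rpow_mul]; norm_num
  have e' : ∀ a : ENNReal, (a ^ (1 / 2 : ℝ)) ^ 2 = a := fun a => by
    rw [← ENNReal.rpow_natCast, ← ENNReal.rpow_mul]; norm_num
  simp only [e] at this
  calc _ ≤ _ := pow_le_pow_left₀ zero_le this 2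
    _ = _ := by rw [mul_pow, e', e']

end General

section Mollification

/-- Convolution on `ℝ³` of a normalised bump function with `f`. -/
def mollify (φ : ContDiffBump (0 : Pt3)) (f : Pt3 → ℝ) : Pt3 → ℝ :=
  convolution (φ.normed volume) f (ContinuousLinearMap.lsmul ℝ ℝ) volume

lemma mollify_apply (φ : ContDiffBump (0 : Pt3)) (f : Pt3 → ℝ) (x : Pt3) :
    mollify φ f x = ∫ t, φ.normed volume t * f (x - t) := by
  simp [mollify, convolution_def]

lemma contDiff_mollify (φ : ContDiffBump (0 : Pt3)) {f : Pt3 → ℝ} (hf : MemLp f 2) :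
    ContDiff ℝ (⊤ : ℕ∞) (mollify φ f) :=
  φ.hasCompactSupport_normed.contDiff_convolution_left _ φ.contDiff_normed
    (hf.locallyIntegrable (by norm_num))

lemma lintegral_mollify_sq_le (φ : ContDiffBump (0 : Pt3)) {f : Pt3 → ℝ} (hf : Measurable f) :
    ∫⁻ x, ‖mollify φ f x‖ₑ ^ 2 ≤ ∫⁻ x, ‖f x‖ₑ ^ 2 := by
  set k := φ.normed (volume : Measure Pt3) with hk
  have hkc : Continuous k := φ.continuous_normed
  have hk1 : ∫⁻ t, ‖k t‖ₑ = 1 := by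
    have := ofReal_integral_eq_lintegral_ofReal (μ := volume) (f := k) φ.integrable_normed
      (ae_of_all _ fun x => φ.nonneg_normed x)
    rw [φ.integral_normed, ENNReal.ofReal_one] at this
    rw [this]
    congr 1 with x
    rw [Real.enorm_eq_ofReal (φ.nonneg_normed x)]
  have e' : ∀ a : ENNReal, (a ^ (1 / 2 : ℝ)) ^ 2 = a := fun a => by
    rw [← ENNReal.rpow_natCast, ← ENNReal.rpow_mul]; norm_num
  have hpt : ∀ x, ‖mollify φ f x‖ₑ ^ 2 ≤ ∫⁻ t, ‖k t‖ₑ * ‖f (x - t)‖ₑ ^ 2 := by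
    intro x
    have hm : Measurable fun t => ‖f (x - t)‖ₑ :=
      (hf.comp (measurable_const.sub measurable_id)).enorm
    have hkm : Measurable fun t => ‖k t‖ₑ ^ (1 / 2 : ℝ) := hkc.measurable.enorm.pow_const _
    calc ‖mollify φ f x‖ₑ ^ 2
        ≤ (∫⁻ t, ‖k t‖ₑ * ‖f (x - t)‖ₑ) ^ 2 := by
          rw [mollify_apply]
          gcongr
          refine (enorm_integral_le_lintegral_enorm _).trans (le_of_eq ?_)
          simp only [enorm_mul]; rfl
      _ = (∫⁻ t, ‖k t‖ₑ ^ (1 / 2 : ℝ) * (‖k t‖ₑ ^ (1 / 2 : ℝ) * ‖f (x - t)‖ₑ)) ^ 2 := by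
          congr 2 with t
          rw [← mul_assoc, ← sq, e']
      _ ≤ (∫⁻ t, (‖k t‖ₑ ^ (1 / 2 : ℝ)) ^ 2)
            * ∫⁻ t, (‖k t‖ₑ ^ (1 / 2 : ℝ) * ‖f (x - t)‖ₑ) ^ 2 :=
          lintegral_mul_sq_le hkm.aemeasurable (hkm.mul hm).aemeasurable
      _ = _ := by simp only [mul_pow, e', hk1, one_mul]
  calc ∫⁻ x, ‖mollify φ f x‖ₑ ^ 2 ≤ ∫⁻ x, ∫⁻ t, ‖k t‖ₑ * ‖f (x - t)‖ₑ ^ 2 :=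
        lintegral_mono hpt
    _ = ∫⁻ t, ∫⁻ x, ‖k t‖ₑ * ‖f (x - t)‖ₑ ^ 2 := by
        apply lintegral_lintegral_swap
        have h1 : Measurable fun p : Pt3 × Pt3 => ‖k p.2‖ₑ :=
          (hkc.measurable.comp measurable_snd).enorm
        have h2 : Measurable fun p : Pt3 × Pt3 => ‖f (p.1 - p.2)‖ₑ :=
          (hf.comp (measurable_fst.sub measurable_snd)).enorm
        exact (h1.mul (h2.pow_const 2)).aemeasurable
    _ = ∫⁻ t, ‖k t‖ₑ * ∫⁻ x, ‖f x‖ₑ ^ 2 := by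
        congr 1 with t
        rw [lintegral_const_mul]
        · rw [lintegral_sub_right_eq_self (fun x => ‖f x‖ₑ ^ 2) t]
        · exact ((hf.comp (measurable_id.sub measurable_const)).enorm).pow_const 2
    _ = _ := by
        rw [lintegral_mul_const _ hkc.measurable.enorm, hk1, one_mul]

lemma memLp_mollify (φ : ContDiffBump (0 : Pt3)) {f : Pt3 → ℝ} (hf : Measurable f)
    (h2 : MemLp f 2) : MemLp (mollify φ f) 2 := by
  refine memLp_two_of_lintegral_lt_top
    (contDiff_mollify φ h2).continuous.aestronglyMeasurable ?_
  refine (lintegral_mollify_sq_le φ hf).trans_lt ?_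
  rw [lintegral_enorm_sq_eq h2]
  exact ENNReal.ofReal_lt_top

lemma integral_mollify_sq_le (φ : ContDiffBump (0 : Pt3)) {f : Pt3 → ℝ} (hf : Measurable f)
    (h2 : MemLp f 2) : ∫ x, mollify φ f x ^ 2 ≤ ∫ x, f x ^ 2 := by
  refine integral_sq_le_of_lintegral_le (memLp_mollify φ hf h2)
    (integral_nonneg fun _ => sq_nonneg _) ?_
  rw [← lintegral_enorm_sq_eq h2]
  exact lintegral_mollify_sq_le φ hf

/-- `w` is a continuous square integrable function on `ℝ³` whose weak gradient is the square
integrable field `g`. -/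
structure WGrad (w : Pt3 → ℝ) (g : Fin 3 → Pt3 → ℝ) : Prop where
  cont : Continuous w
  memLp : MemLp w 2
  measGrad : ∀ i, Measurable (g i)
  memGrad : ∀ i, MemLp (g i) 2
  weak : ∀ φ : Pt3 → ℝ, ContDiff ℝ (⊤ : ℕ∞) φ → HasCompactSupport φ → ∀ i,
    ∫ x, w x * grad3 φ x i = -∫ x, g i x * φ x

lemma WGrad.grad3_mollify {w : Pt3 → ℝ} {g : Fin 3 → Pt3 → ℝ} (h : WGrad w g)
    (φ : ContDiffBump (0 : Pt3)) (x : Pt3) (i : Fin 3) :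
    grad3 (mollify φ w) x i = mollify φ (g i) x := by
  have hk : ContDiff ℝ (⊤ : ℕ∞) (φ.normed (volume : Measure Pt3)) := φ.contDiff_normed
  have hloc : LocallyIntegrable w volume := h.memLp.locallyIntegrable (by norm_num)
  have hk1 : ContDiff ℝ 1 (φ.normed (volume : Measure Pt3)) := φ.contDiff_normed
  have hcs : HasCompactSupport (φ.normed (volume : Measure Pt3)) := φ.hasCompactSupport_normed
  have hD := hcs.hasFDerivAt_convolution_left (ContinuousLinearMap.lsmul ℝ ℝ) hk1 hloc x
  rw [grad3, mollify, hD.fderiv, convolution_def, ContinuousLinearMap.integral_apply]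
  swap
  · exact (hcs.fderiv ℝ).convolutionExists_left _ (hk1.continuous_fderiv one_ne_zero) hloc x
  have hw := h.weak (fun z => φ.normed volume (x - z)) (hk.comp (contDiff_const.sub contDiff_id))
    (hcs.comp_homeomorph (Homeomorph.subLeft x)) i
  have hgr : ∀ z, grad3 (fun z => φ.normed volume (x - z)) z i
      = - fderiv ℝ (φ.normed volume) (x - z) (e3 i) := by
    intro z
    have h1 : HasFDerivAt (fun z : Pt3 => x - z) (-(ContinuousLinearMap.id ℝ Pt3)) z :=
      (hasFDerivAt_id z).const_sub x
    have h2 := ((hk1.differentiable one_ne_zero (x - z)).hasFDerivAt).comp z h1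
    have h3 := h2.fderiv
    rw [grad3]
    erw [h3]
    simp
  simp only [hgr, mul_neg, integral_neg, neg_inj] at hw
  rw [mollify_apply, ← integral_sub_left_eq_self _ volume x]
  rw [← integral_sub_left_eq_self (fun t => φ.normed volume t * g i (x - t)) volume x]
  simp only [ContinuousLinearMap.precompL_apply, ContinuousLinearMap.lsmul_apply, sub_sub_cancel,
    smul_eq_mul]
  simp only [mul_comm _ (w _), mul_comm _ (g i _)]
  exact hw

end Mollification

section Approximation

lemma exists_cutoff : ∃ χ : Pt3 → ℝ, ContDiff ℝ (⊤ : ℕ∞) χ ∧ HasCompactSupport χ ∧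
    (∀ x, 0 ≤ χ x) ∧ (∀ x, χ x ≤ 1) ∧ (∀ x, ‖x‖ ≤ 1 → χ x = 1) ∧
    ∃ C : ℝ, 0 ≤ C ∧ ∀ x i, |fderiv ℝ χ x (e3 i)| ≤ C := by
  let χ : ContDiffBump (0 : Pt3) := ⟨1, 2, one_pos, one_lt_two⟩
  have hc : ContDiff ℝ (⊤ : ℕ∞) χ := χ.contDiff
  refine ⟨χ, hc, χ.hasCompactSupport, fun x => χ.nonneg, fun x => χ.le_one, fun x hx => ?_, ?_⟩
  · exact χ.one_of_mem_closedBall (by simpa using hx)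
  have hcf : Continuous (fderiv ℝ χ) := hc.continuous_fderiv (by simp)
  obtain ⟨C, hC⟩ := hcf.bounded_above_of_compact_support (χ.hasCompactSupport.fderiv ℝ)
  refine ⟨C, (norm_nonneg _).trans (hC 0), fun x i => ?_⟩
  calc |fderiv ℝ χ x (e3 i)| ≤ ‖fderiv ℝ χ x‖ * ‖e3 i‖ := (fderiv ℝ χ x).le_opNorm _
    _ ≤ C * 1 := by
        gcongr
        · exact (norm_nonneg _).trans (hC 0)
        · exact hC x
        · rw [pi_norm_le_iff_of_nonneg zero_le_one]
          intro j
          by_cases hj : j = i <;> simp [e3, hj]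
    _ = C := mul_one C

lemma add_sq_le_weighted {N : ℝ} (hN : 0 < N) (a b : ℝ) :
    (a + b) ^ 2 ≤ (1 + 1 / N) * a ^ 2 + (1 + N) * b ^ 2 := by
  have : (1 + 1 / N) * a ^ 2 + (1 + N) * b ^ 2 - (a + b) ^ 2 = (a - N * b) ^ 2 / N := by
    field_simp
    ring
  have h2 : 0 ≤ (a - N * b) ^ 2 / N := by positivity
  linarith

lemma WGrad.exists_approx {w : Pt3 → ℝ} {g : Fin 3 → Pt3 → ℝ} (h : WGrad w g) :
    ∃ W : ℕ → Pt3 → ℝ, (∀ n, ContDiff ℝ (⊤ : ℕ∞) (W n)) ∧ (∀ n, HasCompactSupport (W n)) ∧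
      (∀ x, Tendsto (fun n => W n x) atTop (nhds (w x))) ∧
      (∀ n, ∫ x, W n x ^ 2 ≤ ∫ x, w x ^ 2) ∧
      ∃ c : ℕ → ℝ, Tendsto c atTop (nhds (∑ i, ∫ x, g i x ^ 2)) ∧
        ∀ n, ∫ x, gradSq3 (W n) x ≤ c n := by
  obtain ⟨χ, hχ, hχs, hχ0, hχ1, hχe, C, hC0, hC⟩ := exists_cutoff
  let φ : ℕ → ContDiffBump (0 : Pt3) := fun n =>
    ⟨1 / (2 * ((n : ℝ) + 1)), 1 / ((n : ℝ) + 1), by positivity, by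
      apply one_div_lt_one_div_of_lt <;> linarith [n.cast_nonneg (α := ℝ)]⟩
  have hφ : Tendsto (fun n => (φ n).rOut) atTop (nhds 0) :=
    tendsto_one_div_add_atTop_nhds_zero_nat
  let N : ℕ → ℝ := fun n => (n : ℝ) + 1
  have hN : ∀ n, 0 < N n := fun n => by positivity
  let X : ℕ → Pt3 → ℝ := fun n x => χ ((N n)⁻¹ • x)
  have hXc : ∀ n, ContDiff ℝ (⊤ : ℕ∞) (X n) := fun n => hχ.comp (contDiff_const_smul _)
  have hXs : ∀ n, HasCompactSupport (X n) := fun n =>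
    hχs.comp_homeomorph (Homeomorph.smulOfNeZero (N n)⁻¹ (inv_ne_zero (hN n).ne'))
  have hXd : ∀ n x i, |fderiv ℝ (X n) x (e3 i)| ≤ C / N n := by
    intro n x i
    have h1 : HasFDerivAt (fun x : Pt3 => (N n)⁻¹ • x) ((N n)⁻¹ • ContinuousLinearMap.id ℝ Pt3) x :=
      ((N n)⁻¹ • ContinuousLinearMap.id ℝ Pt3).hasFDerivAt
    have h2 := ((hχ.differentiable (by simp) ((N n)⁻¹ • x)).hasFDerivAt).comp x h1
    have h3 : fderiv ℝ (X n) x = _ := h2.fderiv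
    rw [h3]
    simp only [ContinuousLinearMap.comp_apply, smul_apply,
      ContinuousLinearMap.id_apply, map_smul, smul_eq_mul, abs_mul]
    rw [abs_of_pos (inv_pos.2 (hN n)), inv_mul_eq_div]
    gcongr
    exact hC _ _
  let W : ℕ → Pt3 → ℝ := fun n x => X n x * mollify (φ n) w x
  have hmc : ∀ n, ContDiff ℝ (⊤ : ℕ∞) (mollify (φ n) w) := fun n => contDiff_mollify _ h.memLp
  have hWc : ∀ n, ContDiff ℝ (⊤ : ℕ∞) (W n) := fun n => (hXc n).mul (hmc n)
  have hWs : ∀ n, HasCompactSupport (W n) := fun n => (hXs n).mul_right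
  have hw2 : ∀ n, MemLp (mollify (φ n) w) 2 := fun n => memLp_mollify _ h.cont.measurable h.memLp
  have hg2 : ∀ n i, MemLp (mollify (φ n) (g i)) 2 :=
    fun n i => memLp_mollify _ (h.measGrad i) (h.memGrad i)
  refine ⟨W, hWc, hWs, fun x => ?_, fun n => ?_,
    fun n => (1 + 1 / N n) * (∑ i, ∫ x, g i x ^ 2)
      + 3 * ((1 + N n) * (C / N n) ^ 2 * ∫ x, w x ^ 2), ?_, fun n => ?_⟩
  · have h1 : Tendsto (fun n => mollify (φ n) w x) atTop (nhds (w x)) :=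
      ContDiffBump.convolution_tendsto_right_of_continuous hφ h.cont x
    refine h1.congr' ?_
    filter_upwards [eventually_ge_atTop ⌈‖x‖⌉₊] with n hn
    have hx : ‖x‖ ≤ N n := (Nat.ceil_le.1 hn).trans (by simp [N])
    have : X n x = 1 := hχe _ (by
      rw [norm_smul, norm_inv, Real.norm_of_nonneg (hN n).le, inv_mul_le_one₀ (hN n)]
      exact hx)
    simp [W, this]
  · refine le_trans (integral_mono_of_nonneg (ae_of_all _ fun x => sq_nonneg _)
      (hw2 n).integrable_sq (ae_of_all _ fun x => ?_))
      (integral_mollify_sq_le (φ n) h.cont.measurable h.memLp)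
    simp only [W, mul_pow]
    exact mul_le_of_le_one_left (sq_nonneg _) (pow_le_one₀ (hχ0 _) (hχ1 _))
  · have hNt : Tendsto (fun n => 1 / N n) atTop (nhds 0) :=
      tendsto_one_div_add_atTop_nhds_zero_nat
    have : Tendsto (fun n => (1 + 1 / N n) * (∑ i, ∫ x, g i x ^ 2)
      + 3 * (((1 / N n) ^ 2 + 1 / N n) * C ^ 2 * ∫ x, w x ^ 2)) atTop
      (nhds ((1 + 0) * (∑ i, ∫ x, g i x ^ 2) + 3 * ((0 ^ 2 + 0) * C ^ 2 * ∫ x, w x ^ 2))) :=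
      ((hNt.const_add 1).mul_const _).add
        (((((hNt.pow 2).add hNt).mul_const _).mul_const _).const_mul _)
    simp only [add_zero, one_mul, ne_eq, OfNat.ofNat_ne_zero, not_false_eq_true, zero_pow,
      zero_mul, mul_zero] at this
    refine this.congr fun n => ?_
    have := (hN n).ne'
    field_simp
  · have hgr : ∀ x i, grad3 (W n) x i
        = X n x * mollify (φ n) (g i) x + fderiv ℝ (X n) x (e3 i) * mollify (φ n) w x := by
      intro x i
      rw [← h.grad3_mollify (φ n) x i, grad3, grad3]
      have := ((hXc n).differentiable (by simp) x).hasFDerivAt.mul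
        ((hmc n).differentiable (by simp) x).hasFDerivAt
      have h3 : fderiv ℝ (W n) x = _ := this.fderiv
      rw [h3]
      simp only [add_apply, smul_apply, smul_eq_mul]
      ring
    have hint : Integrable (fun x => ∑ i, ((1 + 1 / N n) * mollify (φ n) (g i) x ^ 2
        + (1 + N n) * (C / N n) ^ 2 * mollify (φ n) w x ^ 2)) :=
      integrable_finsetSum _ fun i _ => ((hg2 n i).integrable_sq.const_mul _).add
        ((hw2 n).integrable_sq.const_mul _)
    have hNn := hN n
    have hb : ∫ x, gradSq3 (W n) x ≤ ∫ x, ∑ i, ((1 + 1 / N n) * mollify (φ n) (g i) x ^ 2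
        + (1 + N n) * (C / N n) ^ 2 * mollify (φ n) w x ^ 2) := by
      refine integral_mono_of_nonneg (ae_of_all _ fun x => Finset.sum_nonneg fun i _ => sq_nonneg _)
        hint (ae_of_all _ fun x => Finset.sum_le_sum fun i _ => ?_)
      rw [hgr]
      refine (add_sq_le_weighted hNn _ _).trans ?_
      rw [mul_assoc (1 + N n), mul_pow, mul_pow]
      refine add_le_add (mul_le_mul_of_nonneg_left ?_ (by positivity))
        (mul_le_mul_of_nonneg_left (mul_le_mul_of_nonneg_right ?_ (sq_nonneg _)) (by positivity))
      · exact mul_le_of_le_one_left (sq_nonneg _) (pow_le_one₀ (hχ0 _) (hχ1 _))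
      · exact sq_le_sq.2 ((hXd n x i).trans (le_abs_self _))
    refine hb.trans ?_
    rw [integral_finsetSum Finset.univ (f := fun i x => (1 + 1 / N n) * mollify (φ n) (g i) x ^ 2
        + (1 + N n) * (C / N n) ^ 2 * mollify (φ n) w x ^ 2)
      fun i _ => ((hg2 n i).integrable_sq.const_mul _).add ((hw2 n).integrable_sq.const_mul _)]
    beta_reduce
    rw [Finset.mul_sum]
    have h3 : 3 * ((1 + N n) * (C / N n) ^ 2 * ∫ x, w x ^ 2)
        = ∑ _i : Fin 3, (1 + N n) * (C / N n) ^ 2 * ∫ x, w x ^ 2 := by simp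
    rw [h3, ← Finset.sum_add_distrib]
    refine Finset.sum_le_sum fun i _ => ?_
    rw [integral_add ((hg2 n i).integrable_sq.const_mul _) ((hw2 n).integrable_sq.const_mul _),
      integral_const_mul, integral_const_mul]
    exact add_le_add
      (mul_le_mul_of_nonneg_left
        (integral_mollify_sq_le (φ n) (h.measGrad i) (h.memGrad i)) (by positivity))
      (mul_le_mul_of_nonneg_left
        (integral_mollify_sq_le (φ n) h.cont.measurable h.memLp) (by positivity))

end Approximation

section Sobolev

lemma abs_fderiv_le (L : Pt3 →L[ℝ] ℝ) : ‖L‖ ^ 2 ≤ 3 * ∑ i, L (e3 i) ^ 2 := by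
  have h1 : ‖L‖ ≤ ∑ i, |L (e3 i)| := by
    refine L.opNorm_le_bound (Finset.sum_nonneg fun i _ => abs_nonneg _) fun x => ?_
    have hx : x = ∑ i, x i • e3 i := by
      ext j
      simp [e3, Finset.sum_apply]
    conv_lhs => rw [hx]
    rw [map_sum, Finset.sum_mul]
    refine (norm_sum_le _ _).trans (Finset.sum_le_sum fun i _ => ?_)
    rw [map_smul, norm_smul, mul_comm]
    gcongr
    · exact le_rfl
    · exact norm_le_pi_norm x i
  calc ‖L‖ ^ 2 ≤ (∑ i, |L (e3 i)|) ^ 2 := by gcongr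
    _ ≤ 3 * ∑ i, |L (e3 i)| ^ 2 := by
        have := sq_sum_le_card_mul_sum_sq (s := Finset.univ) (f := fun i : Fin 3 => |L (e3 i)|)
        simpa using this
    _ = _ := by simp

/-- The Sobolev inequality `H¹(ℝ³) ⊂ L⁶(ℝ³)`. -/
theorem exists_sobolev_const : ∃ C : ℝ, 0 ≤ C ∧ ∀ w g, WGrad w g →
    ∫⁻ x, ‖w x‖ₑ ^ 6 ≤ ENNReal.ofReal (C * (∑ i, ∫ x, g i x ^ 2) ^ 3) := by
  let K : NNReal := SNormLESNormFDerivOfEqConst ℝ (volume : Measure Pt3) ((2 : NNReal) : ℝ)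
  have key : ∀ W : Pt3 → ℝ, ContDiff ℝ (⊤ : ℕ∞) W → HasCompactSupport W →
      ∫⁻ x, ‖W x‖ₑ ^ 6 ≤ ENNReal.ofReal ((K : ℝ) ^ 6 * 27 * (∫ x, gradSq3 W x) ^ 3) := by
    intro W hW hWs
    have hW1 : ContDiff ℝ 1 W := hW.of_le (by exact_mod_cast le_top)
    have h1 : eLpNorm W ((6 : NNReal) : ENNReal) volume ≤
        K * eLpNorm (fderiv ℝ W) ((2 : NNReal) : ENNReal) volume := by
      apply eLpNorm_le_eLpNorm_fderiv_of_eq volume hW1 hWs (by norm_num) (by simp)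
      simp; norm_num
    rw [eLpNorm_nnreal_eq_lintegral (by norm_num), eLpNorm_nnreal_eq_lintegral (by norm_num)] at h1
    have hint : Integrable (gradSq3 W) := by
      refine integrable_finsetSum _ fun i _ => ?_
      have hc : Continuous fun x => fderiv ℝ W x (e3 i) :=
        (hW1.continuous_fderiv one_ne_zero).clm_apply continuous_const
      have hs : HasCompactSupport fun x => fderiv ℝ W x (e3 i) := hWs.fderiv_apply ℝ _
      have h2 : MemLp (fun x => fderiv ℝ W x (e3 i)) 2 volume := hc.memLp_of_hasCompactSupport hs
      exact h2.integrable_sq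
    have h2 : ∫⁻ x, ‖fderiv ℝ W x‖ₑ ^ ((2 : NNReal) : ℝ)
        ≤ ENNReal.ofReal (3 * ∫ x, gradSq3 W x) := by
      rw [← integral_const_mul, ofReal_integral_eq_lintegral_ofReal (hint.const_mul 3)
        (ae_of_all _ fun x => mul_nonneg (by norm_num)
          (Finset.sum_nonneg fun i _ => sq_nonneg _))]
      refine lintegral_mono fun x => ?_
      simp only [NNReal.coe_ofNat, ENNReal.rpow_ofNat]
      rw [← ofReal_norm, ← ENNReal.ofReal_pow (norm_nonneg _)]
      exact ENNReal.ofReal_le_ofReal (abs_fderiv_le _)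
    have h0 : 0 ≤ ∫ x, gradSq3 W x :=
      integral_nonneg fun x => Finset.sum_nonneg fun i _ => sq_nonneg _
    have h3 := ENNReal.rpow_le_rpow h1 (by norm_num : (0 : ℝ) ≤ 6)
    rw [← ENNReal.rpow_mul, ENNReal.mul_rpow_of_nonneg _ _ (by norm_num), ← ENNReal.rpow_mul] at h3
    norm_num at h3
    refine h3.trans ?_
    have e1 : ENNReal.ofReal ((K : ℝ) ^ 6 * 27 * (∫ x, gradSq3 W x) ^ 3)
        = (K : ENNReal) ^ 6 * (ENNReal.ofReal (3 * ∫ x, gradSq3 W x)) ^ 3 := by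
      rw [← ENNReal.ofReal_coe_nnreal (p := K), ← ENNReal.ofReal_pow K.coe_nonneg,
        ← ENNReal.ofReal_pow (by positivity), ← ENNReal.ofReal_mul (by positivity)]
      congr 1; ring
    rw [e1]
    gcongr
    simpa using h2
  refine ⟨(K : ℝ) ^ 6 * 27, by positivity, fun w g h => ?_⟩
  obtain ⟨W, hWc, hWs, hWt, -, c, hc, hcW⟩ := h.exists_approx
  have h1 : ∫⁻ x, ‖w x‖ₑ ^ 6 = ∫⁻ x, liminf (fun n => ‖W n x‖ₑ ^ 6) atTop := by
    congr 1 with x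
    exact (((ENNReal.continuous_pow 6).comp continuous_enorm).tendsto _ |>.comp (hWt x)).liminf_eq.symm
  rw [h1]
  refine (lintegral_liminf_le fun n => ((hWc n).continuous.measurable.enorm.pow_const 6)).trans ?_
  have h2 : Tendsto (fun n => ENNReal.ofReal ((K : ℝ) ^ 6 * 27 * c n ^ 3)) atTop
      (nhds (ENNReal.ofReal ((K : ℝ) ^ 6 * 27 * (∑ i, ∫ x, g i x ^ 2) ^ 3))) :=
    ENNReal.tendsto_ofReal ((hc.pow 3).const_mul _)
  rw [← h2.liminf_eq]
  refine liminf_le_liminf (Eventually.of_forall fun n => (key _ (hWc n) (hWs n)).trans ?_)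
  have h0 : 0 ≤ ∫ x, gradSq3 (W n) x :=
    integral_nonneg fun x => Finset.sum_nonneg fun i _ => sq_nonneg _
  have := hcW n
  gcongr

end Sobolev

section WholeSpace

lemma measurable_grad3 {w : Pt3 → ℝ} (i : Fin 3) : Measurable fun x => grad3 w x i :=
  measurable_fderiv_apply_const ℝ w (e3 i)

lemma wgrad_of_differentiable {w : Pt3 → ℝ} (hd : Differentiable ℝ w) (h2 : MemLp w 2)
    (hg : ∀ i, MemLp (fun x => grad3 w x i) 2) : WGrad w fun i x => grad3 w x i where
  cont := hd.continuous
  memLp := h2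
  measGrad := measurable_grad3
  memGrad := hg
  weak φ hφ hφs i := by
    have hφ1 : ContDiff ℝ 1 φ := hφ.of_le (by exact_mod_cast le_top)
    have hφd : Differentiable ℝ φ := hφ1.differentiable one_ne_zero
    have hφ2 : MemLp φ 2 volume := hφ.continuous.memLp_of_hasCompactSupport hφs
    have hφ3 : MemLp (fun x => fderiv ℝ φ x (e3 i)) 2 volume :=
      ((hφ1.continuous_fderiv one_ne_zero).clm_apply
        continuous_const).memLp_of_hasCompactSupport (hφs.fderiv_apply ℝ _)
    exact integral_mul_fderiv_eq_neg_fderiv_mul_of_integrable (v := e3 i)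
      ((hg i).integrable_mul hφ2) (h2.integrable_mul hφ3) (h2.integrable_mul hφ2) (fun x _ => hd x)
      (fun x _ => hφd x)

lemma lintegral_pow_four_sq_le {w : Pt3 → ℝ} (hw : Continuous w) :
    (∫⁻ x, ‖w x‖ₑ ^ 4) ^ 2 ≤ (∫⁻ x, ‖w x‖ₑ ^ 2) * ∫⁻ x, ‖w x‖ₑ ^ 6 := by
  have := lintegral_mul_sq_le (μ := volume) (f := fun x => ‖w x‖ₑ) (g := fun x => ‖w x‖ₑ ^ 3)
    hw.measurable.enorm.aemeasurable (hw.measurable.enorm.pow_const 3).aemeasurable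
  simpa only [← pow_succ', ← pow_mul] using this

/-- A Gagliardo–Nirenberg inequality on `ℝ³`. -/
theorem exists_gagliardo_nirenberg_const : ∃ C : ℝ, 0 < C ∧ ∀ w g, WGrad w g →
    Integrable (fun x => w x ^ 4) ∧
      (∫ x, w x ^ 4) ^ 2 ≤ C * (∫ x, w x ^ 2) * (∑ i, ∫ x, g i x ^ 2) ^ 3 := by
  obtain ⟨C, hC, hS⟩ := exists_sobolev_const
  refine ⟨C + 1, by linarith, fun w g h => ?_⟩
  have h1 := lintegral_pow_four_sq_le h.cont
  have hG : 0 ≤ ∑ i, ∫ x, g i x ^ 2 :=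
    Finset.sum_nonneg fun i _ => integral_nonneg fun x => sq_nonneg _
  have hM : 0 ≤ ∫ x, w x ^ 2 := integral_nonneg fun x => sq_nonneg _
  rw [lintegral_enorm_sq_eq h.memLp] at h1
  have h2 : (∫⁻ x, ‖w x‖ₑ ^ 4) ^ 2
      ≤ ENNReal.ofReal ((C + 1) * (∫ x, w x ^ 2) * (∑ i, ∫ x, g i x ^ 2) ^ 3) := by
    refine h1.trans ?_
    rw [mul_comm (C + 1), mul_assoc, ENNReal.ofReal_mul hM]
    gcongr
    refine (hS w g h).trans (ENNReal.ofReal_le_ofReal ?_)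
    gcongr
    linarith
  have e4 : ∀ x, ‖w x‖ₑ ^ 4 = ENNReal.ofReal (w x ^ 4) := fun x => by
    rw [show 4 = 2 * 2 from rfl, pow_mul, pow_mul, enorm_sq_eq, ENNReal.ofReal_pow (sq_nonneg _)]
  simp only [e4] at h2
  have hi : Integrable (fun x => w x ^ 4) := by
    refine ⟨(h.cont.pow 4).aestronglyMeasurable, ?_⟩
    rw [hasFiniteIntegral_iff_ofReal (ae_of_all _ fun x => by positivity)]
    by_contra hcon
    rw [not_lt, top_le_iff] at hcon
    rw [hcon] at h2
    simp at h2
  refine ⟨hi, ?_⟩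
  rw [← ofReal_integral_eq_lintegral_ofReal hi (ae_of_all _ fun x => by positivity),
    ← ENNReal.ofReal_pow (integral_nonneg fun x => by positivity)] at h2
  exact (ENNReal.ofReal_le_ofReal_iff (by positivity)).1 h2

lemma memLp_two_of_integrable_sq {α : Type*} [MeasurableSpace α] {μ : Measure α} {f : α → ℝ}
    (hf : Measurable f) (h : Integrable (fun x => f x ^ 2) μ) : MemLp f 2 μ :=
  (memLp_two_iff_integrable_sq hf.aestronglyMeasurable).2 h

lemma H1R3.memLp {w : Pt3 → ℝ} (h : H1R3 w) : MemLp w 2 :=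
  memLp_two_of_integrable_sq h.diff.continuous.measurable h.memL2

lemma H1R3.memLp_grad {w : Pt3 → ℝ} (h : H1R3 w) (i : Fin 3) :
    MemLp (fun x => grad3 w x i) 2 := by
  refine memLp_two_of_integrable_sq (measurable_grad3 i) ?_
  refine h.memGrad.mono' ((measurable_grad3 i).pow_const 2).aestronglyMeasurable
    (ae_of_all _ fun x => ?_)
  rw [Real.norm_of_nonneg (sq_nonneg _)]
  exact Finset.single_le_sum (f := fun i => grad3 w x i ^ 2) (fun i _ => sq_nonneg _)
    (Finset.mem_univ i)

lemma H1R3.wgrad {w : Pt3 → ℝ} (h : H1R3 w) : WGrad w fun i x => grad3 w x i :=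
  wgrad_of_differentiable h.diff h.memLp h.memLp_grad

lemma H1R3.integral_gradSq3 {w : Pt3 → ℝ} (h : H1R3 w) :
    ∫ x, gradSq3 w x = ∑ i, ∫ x, grad3 w x i ^ 2 :=
  integral_finsetSum _ (f := fun i x => grad3 w x i ^ 2) fun i _ => (h.memLp_grad i).integrable_sq

lemma H1R3.of_memLp {w : Pt3 → ℝ} (hd : Differentiable ℝ w) (h2 : MemLp w 2)
    (hg : ∀ i, MemLp (fun x => grad3 w x i) 2) : H1R3 w where
  diff := hd
  memL2 := h2.integrable_sq
  memGrad := integrable_finsetSum _ (f := fun i x => grad3 w x i ^ 2)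
    fun i _ => (hg i).integrable_sq
  memL4 := by
    obtain ⟨C, -, h⟩ := exists_gagliardo_nirenberg_const
    exact (h _ _ (wgrad_of_differentiable hd h2 hg)).1

lemma H1R3.of_contDiff {w : Pt3 → ℝ} (hw : ContDiff ℝ (⊤ : ℕ∞) w) (hs : HasCompactSupport w) :
    H1R3 w := by
  have hw1 : ContDiff ℝ 1 w := hw.of_le (by exact_mod_cast le_top)
  exact H1R3.of_memLp (hw1.differentiable one_ne_zero)
    (hw.continuous.memLp_of_hasCompactSupport hs) fun i =>
      ((hw1.continuous_fderiv one_ne_zero).clm_apply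
        continuous_const).memLp_of_hasCompactSupport (hs.fderiv_apply ℝ _)

lemma grad3_linComb {u v : Pt3 → ℝ} (hu : Differentiable ℝ u) (hv : Differentiable ℝ v)
    (a b : ℝ) (x : Pt3) (i : Fin 3) :
    grad3 (fun x => a * u x + b * v x) x i = a * grad3 u x i + b * grad3 v x i := by
  have h : HasFDerivAt (fun x => a * u x + b * v x) (a • fderiv ℝ u x + b • fderiv ℝ v x) x :=
    ((hu x).hasFDerivAt.const_mul a).add ((hv x).hasFDerivAt.const_mul b)
  simp [grad3, h.fderiv]

lemma H1R3.linComb {u v : Pt3 → ℝ} (hu : H1R3 u) (hv : H1R3 v) (a b : ℝ) :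
    H1R3 fun x => a * u x + b * v x := by
  refine H1R3.of_memLp ((hu.diff.const_mul a).add (hv.diff.const_mul b))
    ((hu.memLp.const_mul a).add (hv.memLp.const_mul b)) fun i => ?_
  simp only [grad3_linComb hu.diff hv.diff]
  exact ((hu.memLp_grad i).const_mul a).add ((hv.memLp_grad i).const_mul b)

lemma gradSq3_rescale {u : Pt3 → ℝ} (hu : Differentiable ℝ u) (α β : ℝ) (x : Pt3) :
    gradSq3 (fun x => α * u (β • x)) x = α ^ 2 * β ^ 2 * gradSq3 u (β • x) := by
  have h1 : HasFDerivAt (fun x : Pt3 => β • x) (β • ContinuousLinearMap.id ℝ Pt3) x :=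
    (β • ContinuousLinearMap.id ℝ Pt3).hasFDerivAt
  have h : HasFDerivAt (fun x => α * u (β • x)) _ x :=
    ((hu (β • x)).hasFDerivAt.comp x h1).const_mul α
  simp only [gradSq3, grad3, h.fderiv, smul_apply, ContinuousLinearMap.comp_apply,
    ContinuousLinearMap.id_apply, map_smul, smul_eq_mul, mul_pow, Finset.mul_sum]
  exact Finset.sum_congr rfl fun i _ => by ring

lemma integral_comp_dilation (f : Pt3 → ℝ) {β : ℝ} (hβ : 0 < β) :
    ∫ x, f (β • x) = (β ^ 3)⁻¹ * ∫ x, f x := by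
  rw [Measure.integral_comp_smul]
  simp [abs_of_pos hβ]

lemma H1R3.rescale {u : Pt3 → ℝ} (hu : H1R3 u) (α : ℝ) {β : ℝ} (hβ : 0 < β) :
    H1R3 fun x => α * u (β • x) where
  diff := (hu.diff.comp (differentiable_id.const_smul β)).const_mul α
  memL2 := by
    simp only [mul_pow]
    exact (hu.memL2.comp_smul hβ.ne').const_mul _
  memGrad := by
    simp only [gradSq3_rescale hu.diff]
    exact (hu.memGrad.comp_smul hβ.ne').const_mul _
  memL4 := by
    simp only [mul_pow]
    exact (hu.memL4.comp_smul hβ.ne').const_mul _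

lemma integral_sq_rescale (u : Pt3 → ℝ) (α : ℝ) {β : ℝ} (hβ : 0 < β) :
    ∫ x, (α * u (β • x)) ^ 2 = α ^ 2 * (β ^ 3)⁻¹ * ∫ x, u x ^ 2 := by
  simp only [mul_pow]
  rw [integral_const_mul, integral_comp_dilation (fun x => u x ^ 2) hβ, mul_assoc]

lemma integral_gradSq3_rescale {u v : Pt3 → ℝ} (hu : Differentiable ℝ u) (hv : Differentiable ℝ v)
    (α : ℝ) {β : ℝ} (hβ : 0 < β) :
    ∫ x, (gradSq3 (fun x => α * u (β • x)) x + gradSq3 (fun x => α * v (β • x)) x)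
      = α ^ 2 * β⁻¹ * ∫ x, (gradSq3 u x + gradSq3 v x) := by
  simp only [gradSq3_rescale hu, gradSq3_rescale hv, ← mul_add]
  rw [integral_const_mul, integral_comp_dilation (fun x => gradSq3 u x + gradSq3 v x) hβ]
  field_simp

lemma integral_nonlin3_rescale (u v : Pt3 → ℝ) (α : ℝ) {β : ℝ} (hβ : 0 < β) :
    ∫ x, nonlin3 (fun x => α * u (β • x)) (fun x => α * v (β • x)) x
      = α ^ 4 * (β ^ 3)⁻¹ * ∫ x, nonlin3 u v x := by
  have : ∀ x, nonlin3 (fun x => α * u (β • x)) (fun x => α * v (β • x)) x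
      = α ^ 4 * nonlin3 u v (β • x) := fun x => by simp only [nonlin3]; ring
  simp only [this]
  rw [integral_const_mul, integral_comp_dilation (nonlin3 u v) hβ, mul_assoc]

lemma nonlin3_eq (u v : Pt3 → ℝ) (x : Pt3) : nonlin3 u v x = (u x ^ 2 + v x ^ 2) ^ 2 := by
  simp only [nonlin3]; ring

lemma H1R3.integrable_nonlin3 {u v : Pt3 → ℝ} (hu : H1R3 u) (hv : H1R3 v) :
    Integrable (nonlin3 u v) := by
  refine ((hu.memL4.add hv.memL4).const_mul 2).mono' ?_ (ae_of_all _ fun x => ?_)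
  · have h1 := hu.diff.continuous
    have h2 := hv.diff.continuous
    unfold nonlin3
    exact Continuous.aestronglyMeasurable (by fun_prop)
  · rw [nonlin3_eq, Real.norm_of_nonneg (sq_nonneg _)]
    simp only [Pi.add_apply]
    nlinarith [sq_nonneg (u x ^ 2 - v x ^ 2)]

lemma integral_nonlin3_nonneg (u v : Pt3 → ℝ) : 0 ≤ ∫ x, nonlin3 u v x :=
  integral_nonneg fun x => by rw [nonlin3_eq]; positivity

lemma integral_gradSq3_nonneg (u v : Pt3 → ℝ) : 0 ≤ ∫ x, (gradSq3 u x + gradSq3 v x) :=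
  integral_nonneg fun _ => add_nonneg (Finset.sum_nonneg fun _ _ => sq_nonneg _)
    (Finset.sum_nonneg fun _ _ => sq_nonneg _)

/-- A non-sharp Gagliardo–Nirenberg inequality for pairs. -/
lemma exists_pair_gagliardo_nirenberg_const : ∃ C : ℝ, 0 < C ∧ ∀ u v, H1R3 u → H1R3 v →
    (∫ x, nonlin3 u v x) ^ 2
      ≤ C * ((∫ x, u x ^ 2) + ∫ x, v x ^ 2) * (∫ x, (gradSq3 u x + gradSq3 v x)) ^ 3 := by
  obtain ⟨C, hC, h⟩ := exists_gagliardo_nirenberg_const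
  refine ⟨8 * C, by positivity, fun u v hu hv => ?_⟩
  have h1 := (h _ _ hu.wgrad).2
  have h2 := (h _ _ hv.wgrad).2
  rw [← hu.integral_gradSq3] at h1
  rw [← hv.integral_gradSq3] at h2
  rw [integral_add hu.memGrad hv.memGrad]
  have hb : ∫ x, nonlin3 u v x ≤ 2 * ((∫ x, u x ^ 4) + ∫ x, v x ^ 4) := by
    rw [← integral_add hu.memL4 hv.memL4, ← integral_const_mul]
    refine integral_mono (hu.integrable_nonlin3 hv) ((hu.memL4.add hv.memL4).const_mul 2)
      fun x => ?_
    simp only [nonlin3_eq]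
    nlinarith [sq_nonneg (u x ^ 2 - v x ^ 2)]
  have hb0 := integral_nonlin3_nonneg u v
  have a1 : 0 ≤ ∫ x, gradSq3 u x :=
    integral_nonneg fun _ => Finset.sum_nonneg fun _ _ => sq_nonneg _
  have a2 : 0 ≤ ∫ x, gradSq3 v x :=
    integral_nonneg fun _ => Finset.sum_nonneg fun _ _ => sq_nonneg _
  have b1 : 0 ≤ ∫ x, u x ^ 2 := integral_nonneg fun _ => sq_nonneg _
  have b2 : 0 ≤ ∫ x, v x ^ 2 := integral_nonneg fun _ => sq_nonneg _
  set a := ∫ x, gradSq3 u x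
  set b := ∫ x, gradSq3 v x
  have c1 : a ^ 3 ≤ (a + b) ^ 3 := by gcongr; linarith
  have c2 : b ^ 3 ≤ (a + b) ^ 3 := by gcongr; linarith
  have d1 : (∫ x, u x ^ 4) ^ 2 ≤ C * (∫ x, u x ^ 2) * (a + b) ^ 3 :=
    h1.trans (mul_le_mul_of_nonneg_left c1 (by positivity))
  have d2 : (∫ x, v x ^ 4) ^ 2 ≤ C * (∫ x, v x ^ 2) * (a + b) ^ 3 :=
    h2.trans (mul_le_mul_of_nonneg_left c2 (by positivity))
  have e1 := pow_le_pow_left₀ hb0 hb 2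
  nlinarith [sq_nonneg ((∫ x, u x ^ 4) - ∫ x, v x ^ 4)]

end WholeSpace

section GroundStateLevel

lemma l2R3_eq_iff {u : Pt3 → ℝ} {ρ : ℝ} (hρ : 0 < ρ) : l2R3 u = ρ ↔ ∫ x, u x ^ 2 = ρ ^ 2 := by
  rw [l2R3, Real.sqrt_eq_iff_mul_self_eq_of_pos hρ, sq ρ, eq_comm]

lemma Ihat_eq_of_Qhat {u v : Pt3 → ℝ} (hQ : Qhat u v = 0) :
    Ihat u v = (∫ x, (gradSq3 u x + gradSq3 v x)) / 6 := by
  rw [Qhat] at hQ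
  rw [Ihat]
  linarith

lemma mhat_le {ρ : ℝ} {u v : Pt3 → ℝ} (hu : H1R3 u) (hv : H1R3 v) (h1 : l2R3 u = ρ)
    (h2 : l2R3 v = ρ) (hQ : Qhat u v = 0) : mhat ρ ≤ Ihat u v := by
  refine csInf_le ⟨0, ?_⟩ ⟨u, v, hu, hv, h1, h2, hQ, rfl⟩
  rintro c ⟨u, v, -, -, -, -, hQ, rfl⟩
  rw [Ihat_eq_of_Qhat hQ]
  have := integral_gradSq3_nonneg u v
  positivity

/-- Rescaling a pair with equal masses onto the constraint set. -/
lemma exists_rescaled_pair {u v : Pt3 → ℝ} (hu : H1R3 u) (hv : H1R3 v) {r ρ : ℝ} (hr : 0 < r)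
    (hρ : 0 < ρ) (h1 : ∫ x, u x ^ 2 = r) (h2 : ∫ x, v x ^ 2 = r)
    (hA : 0 < ∫ x, (gradSq3 u x + gradSq3 v x)) (hB : 0 < ∫ x, nonlin3 u v x) :
    ∃ U V : Pt3 → ℝ, H1R3 U ∧ H1R3 V ∧ l2R3 U = ρ ∧ l2R3 V = ρ ∧ Qhat U V = 0 ∧
      Ihat U V * ρ ^ 2 = 8 / 27 * (∫ x, (gradSq3 u x + gradSq3 v x)) ^ 3 * r
        / (∫ x, nonlin3 u v x) ^ 2 := by
  set A := ∫ x, (gradSq3 u x + gradSq3 v x) with hAd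
  set B := ∫ x, nonlin3 u v x with hBd
  set β := 4 * A * r / (3 * B * ρ ^ 2) with hβd
  have hβ : 0 < β := by positivity
  set α := Real.sqrt (ρ ^ 2 * β ^ 3 / r) with hαd
  have hα : α ^ 2 = ρ ^ 2 * β ^ 3 / r := Real.sq_sqrt (by positivity)
  have hα4 : α ^ 4 = (ρ ^ 2 * β ^ 3 / r) ^ 2 := by rw [← hα]; ring
  have hQ : Qhat (fun x => α * u (β • x)) (fun x => α * v (β • x)) = 0 := by
    rw [Qhat, integral_gradSq3_rescale hu.diff hv.diff α hβ, integral_nonlin3_rescale u v α hβ,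
      ← hAd, ← hBd, hα, hα4]
    have : β * (3 * B * ρ ^ 2) = 4 * A * r := by rw [hβd]; field_simp
    field_simp
    linear_combination (-ρ ^ 2 * β ^ 2) * this
  refine ⟨fun x => α * u (β • x), fun x => α * v (β • x), hu.rescale α hβ, hv.rescale α hβ,
    ?_, ?_, hQ, ?_⟩
  · rw [l2R3_eq_iff hρ, integral_sq_rescale u α hβ, h1, hα]
    field_simp
  · rw [l2R3_eq_iff hρ, integral_sq_rescale v α hβ, h2, hα]
    field_simp
  · rw [Ihat_eq_of_Qhat hQ, integral_gradSq3_rescale hu.diff hv.diff α hβ, ← hAd, hα, hβd]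
    field_simp
    ring

lemma mhat_mul_sq_le {u v : Pt3 → ℝ} (hu : H1R3 u) (hv : H1R3 v) {r ρ : ℝ} (hr : 0 < r)
    (hρ : 0 < ρ) (h1 : ∫ x, u x ^ 2 = r) (h2 : ∫ x, v x ^ 2 = r)
    (hA : 0 < ∫ x, (gradSq3 u x + gradSq3 v x)) (hB : 0 < ∫ x, nonlin3 u v x) :
    mhat ρ * ρ ^ 2 ≤ 8 / 27 * (∫ x, (gradSq3 u x + gradSq3 v x)) ^ 3 * r
        / (∫ x, nonlin3 u v x) ^ 2 := by
  obtain ⟨U, V, hU, hV, h3, h4, hQ, h⟩ := exists_rescaled_pair hu hv hr hρ h1 h2 hA hB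
  rw [← h]
  exact mul_le_mul_of_nonneg_right (mhat_le hU hV h3 h4 hQ) (sq_nonneg _)

lemma integral_nonlin3_pos {u v : Pt3 → ℝ} (hu : H1R3 u) (hv : H1R3 v)
    (h : 0 < ∫ x, u x ^ 2) : 0 < ∫ x, nonlin3 u v x := by
  refine lt_of_le_of_ne (integral_nonlin3_nonneg u v) fun h0 => h.ne' ?_
  have h1 := (integral_eq_zero_iff_of_nonneg (fun x => by
    change 0 ≤ nonlin3 u v x
    rw [nonlin3_eq]; positivity) (hu.integrable_nonlin3 hv)).1 h0.symm
  refine integral_eq_zero_of_ae ?_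
  filter_upwards [h1] with x hx
  simp only [nonlin3_eq, Pi.zero_apply] at hx ⊢
  nlinarith [sq_nonneg (u x), sq_nonneg (v x), pow_eq_zero_iff (n := 2) two_ne_zero |>.1 hx]

lemma integral_gradSq3_pos {u v : Pt3 → ℝ} (hu : H1R3 u) (hv : H1R3 v)
    (h : 0 < ∫ x, u x ^ 2) : 0 < ∫ x, (gradSq3 u x + gradSq3 v x) := by
  obtain ⟨C, -, hC⟩ := exists_pair_gagliardo_nirenberg_const
  refine lt_of_le_of_ne (integral_gradSq3_nonneg u v) fun h0 => ?_
  have := hC u v hu hv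
  rw [← h0] at this
  have h2 := integral_nonlin3_pos hu hv h
  nlinarith

lemma exists_constraint_pair {ρ : ℝ} (hρ : 0 < ρ) : ∃ u v : Pt3 → ℝ, H1R3 u ∧ H1R3 v ∧
    l2R3 u = ρ ∧ l2R3 v = ρ ∧ Qhat u v = 0 := by
  obtain ⟨χ, hχ, hχs, hχ0, hχ1, hχe, -⟩ := exists_cutoff
  have h := H1R3.of_contDiff hχ hχs
  have hpos : 0 < ∫ x, χ x ^ 2 := by
    refine (hχ.continuous.pow 2).integral_pos_of_hasCompactSupport_nonneg_nonzero (x := 0)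
      ?_ (fun x => sq_nonneg _) (by simp [hχe 0 (by simp)])
    exact hχs.comp_left (g := fun t : ℝ => t ^ 2) (by simp)
  obtain ⟨U, V, hU, hV, h1, h2, h3, -⟩ := exists_rescaled_pair h h hpos hρ rfl rfl
    (integral_gradSq3_pos h h hpos) (integral_nonlin3_pos h h hpos)
  exact ⟨U, V, hU, hV, h1, h2, h3⟩

lemma exists_Ihat_lt {ρ c : ℝ} (hρ : 0 < ρ) (hc : mhat ρ < c) : ∃ u v : Pt3 → ℝ, H1R3 u ∧
    H1R3 v ∧ l2R3 u = ρ ∧ l2R3 v = ρ ∧ Qhat u v = 0 ∧ Ihat u v < c := by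
  obtain ⟨u, v, hu, hv, h1, h2, h3⟩ := exists_constraint_pair hρ
  obtain ⟨_, ⟨u, v, hu, hv, h1, h2, h3, rfl⟩, h⟩ :=
    exists_lt_of_csInf_lt (s := {c | ∃ u v : Pt3 → ℝ, H1R3 u ∧ H1R3 v ∧ l2R3 u = ρ ∧ l2R3 v = ρ ∧
      Qhat u v = 0 ∧ Ihat u v = c}) ⟨_, u, v, hu, hv, h1, h2, h3, rfl⟩ hc
  exact ⟨u, v, hu, hv, h1, h2, h3, h⟩

lemma mhat_mul_sq_le_mul_sq {ρ σ : ℝ} (hρ : 0 < ρ) (hσ : 0 < σ) :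
    mhat ρ * ρ ^ 2 ≤ mhat σ * σ ^ 2 := by
  refine le_of_forall_gt fun c hc => ?_
  have hc' : mhat σ < c / σ ^ 2 := (lt_div_iff₀ (by positivity)).2 hc
  obtain ⟨u, v, hu, hv, h1, h2, h3, h4⟩ := exists_Ihat_lt hσ hc'
  rw [l2R3_eq_iff hσ] at h1 h2
  have hm : 0 < ∫ x, u x ^ 2 := by rw [h1]; positivity
  have hA := integral_gradSq3_pos hu hv hm
  refine (mhat_mul_sq_le hu hv (by positivity) hρ h1 h2 hA
    (integral_nonlin3_pos hu hv hm)).trans_lt ?_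
  rw [lt_div_iff₀ (by positivity), Ihat_eq_of_Qhat h3] at h4
  rw [Qhat] at h3
  have hB : ∫ x, nonlin3 u v x = 4 / 3 * ∫ x, (gradSq3 u x + gradSq3 v x) := by linarith
  rw [hB]
  refine lt_of_eq_of_lt ?_ h4
  field_simp
  ring

lemma mhat_eq {ρ : ℝ} (hρ : 0 < ρ) : mhat ρ = mhat 1 / ρ ^ 2 := by
  rw [eq_div_iff (by positivity)]
  have h1 := mhat_mul_sq_le_mul_sq hρ one_pos
  have h2 := mhat_mul_sq_le_mul_sq one_pos hρ
  linarith

lemma mhat_one_pos : 0 < mhat 1 := by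
  obtain ⟨C, hC, h⟩ := exists_pair_gagliardo_nirenberg_const
  have hne : {c | ∃ u v : Pt3 → ℝ, H1R3 u ∧ H1R3 v ∧ l2R3 u = 1 ∧ l2R3 v = 1 ∧
      Qhat u v = 0 ∧ Ihat u v = c}.Nonempty := by
    obtain ⟨u, v, hu, hv, h1, h2, h3⟩ := exists_constraint_pair one_pos
    exact ⟨_, u, v, hu, hv, h1, h2, h3, rfl⟩
  refine lt_of_lt_of_le (b := 8 / (54 * C)) (by positivity) (le_csInf hne ?_)
  rintro _ ⟨u, v, hu, hv, h1, h2, h3, rfl⟩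
  rw [Ihat_eq_of_Qhat h3]
  rw [l2R3_eq_iff one_pos] at h1 h2
  have hA := integral_gradSq3_pos hu hv (by rw [h1]; norm_num)
  have h4 := h u v hu hv
  rw [Qhat] at h3
  rw [h1, h2, show ∫ x, nonlin3 u v x = 4 / 3 * ∫ x, (gradSq3 u x + gradSq3 v x) by linarith] at h4
  set A := ∫ x, (gradSq3 u x + gradSq3 v x)
  have h5 : 16 / 9 ≤ 2 * C * A := by
    refine le_of_mul_le_mul_right ?_ (pow_pos hA 2)
    nlinarith
  rw [div_le_div_iff₀ (by positivity) (by norm_num)]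
  nlinarith

lemma exists_rotation (d e : ℝ) : ∃ a b : ℝ, a ^ 2 + b ^ 2 = 1 ∧
    (a ^ 2 - b ^ 2) * d = 4 * a * b * e := by
  have hc : Continuous fun θ : ℝ => (cos θ ^ 2 - sin θ ^ 2) * d - 4 * cos θ * sin θ * e := by
    fun_prop
  obtain ⟨θ, hθ⟩ : ∃ θ : ℝ, (cos θ ^ 2 - sin θ ^ 2) * d - 4 * cos θ * sin θ * e = 0 := by
    rcases le_total 0 d with h | h
    · exact mem_range_of_exists_le_of_exists_ge hc ⟨π / 2, by simpa using h⟩ ⟨0, by simpa using h⟩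
    · exact mem_range_of_exists_le_of_exists_ge hc ⟨0, by simpa using h⟩ ⟨π / 2, by simpa using h⟩
  exact ⟨cos θ, sin θ, cos_sq_add_sin_sq θ, by linarith⟩

/-- The sharp Gagliardo–Nirenberg inequality for pairs, in terms of the ground-state level. -/
theorem sharp_gagliardo_nirenberg {u v : Pt3 → ℝ} (hu : H1R3 u) (hv : H1R3 v) :
    mhat 1 * (∫ x, nonlin3 u v x) ^ 2 ≤
      8 / 27 * (∫ x, (gradSq3 u x + gradSq3 v x)) ^ 3
        * (((∫ x, u x ^ 2) + ∫ x, v x ^ 2) / 2) := by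
  have hA := integral_gradSq3_nonneg u v
  have hu0 : 0 ≤ ∫ x, u x ^ 2 := integral_nonneg fun _ => sq_nonneg _
  have hv0 : 0 ≤ ∫ x, v x ^ 2 := integral_nonneg fun _ => sq_nonneg _
  rcases (integral_nonlin3_nonneg u v).eq_or_lt with hB | hB
  · rw [← hB]
    simp only [ne_eq, OfNat.ofNat_ne_zero, not_false_eq_true, zero_pow, mul_zero]
    positivity
  obtain ⟨C, -, hC⟩ := exists_pair_gagliardo_nirenberg_const
  obtain ⟨a, b, hab, hrot⟩ := exists_rotation ((∫ x, u x ^ 2) - ∫ x, v x ^ 2) (∫ x, u x * v x)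
  have huv : Integrable (fun x => u x * v x) := hu.memLp.integrable_mul hv.memLp
  have hsq : ∀ s t : ℝ, ∫ x, (s * u x + t * v x) ^ 2
      = s ^ 2 * (∫ x, u x ^ 2) + 2 * s * t * (∫ x, u x * v x) + t ^ 2 * ∫ x, v x ^ 2 := by
    intro s t
    rw [← integral_const_mul, ← integral_const_mul, ← integral_const_mul,
      ← integral_add (hu.memL2.const_mul _) (huv.const_mul _),
      ← integral_add (f := fun x => s ^ 2 * u x ^ 2 + 2 * s * t * (u x * v x))
        ((hu.memL2.const_mul _).add (huv.const_mul _)) (hv.memL2.const_mul _)]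
    exact integral_congr_ae (ae_of_all _ fun x => by ring)
  have hg : ∀ x, gradSq3 (fun x => a * u x + -b * v x) x + gradSq3 (fun x => b * u x + a * v x) x
      = gradSq3 u x + gradSq3 v x := by
    intro x
    simp only [gradSq3, grad3_linComb hu.diff hv.diff, ← Finset.sum_add_distrib]
    refine Finset.sum_congr rfl fun i _ => ?_
    linear_combination (grad3 u x i ^ 2 + grad3 v x i ^ 2) * hab
  have hn : ∀ x, nonlin3 (fun x => a * u x + -b * v x) (fun x => b * u x + a * v x) x
      = nonlin3 u v x := by
    intro x
    simp only [nonlin3_eq]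
    congr 1
    linear_combination (u x ^ 2 + v x ^ 2) * hab
  set r := ((∫ x, u x ^ 2) + ∫ x, v x ^ 2) / 2 with hr
  have hr0 : 0 < r := by
    refine lt_of_le_of_ne (by positivity) fun h0 => ?_
    have := hC u v hu hv
    rw [show (∫ x, u x ^ 2) + ∫ x, v x ^ 2 = 0 by linarith] at this
    nlinarith
  have hA0 : 0 < ∫ x, (gradSq3 u x + gradSq3 v x) := by
    refine lt_of_le_of_ne hA fun h0 => ?_
    have := hC u v hu hv
    rw [← h0] at this
    nlinarith
  have h := mhat_mul_sq_le (ρ := 1) (r := r) (hu.linComb hv a (-b)) (hu.linComb hv b a) hr0 one_pos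
    (by
      rw [hsq, hr]
      linear_combination (1 / 2) * hrot + (1 / 2 * ((∫ x, u x ^ 2) + ∫ x, v x ^ 2)) * hab)
    (by
      rw [hsq, hr]
      linear_combination -(1 / 2) * hrot + (1 / 2 * ((∫ x, u x ^ 2) + ∫ x, v x ^ 2)) * hab)
    (by simpa only [hg] using hA0) (by simpa only [hn] using hB)
  simp only [hg, hn, one_pow, mul_one] at h
  rwa [le_div_iff₀ (by positivity)] at h

end GroundStateLevel

section SharpWeak

lemma WGrad.integrable_nonlin3 {p q : Pt3 → ℝ} {G H : Fin 3 → Pt3 → ℝ} (hp : WGrad p G)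
    (hq : WGrad q H) : Integrable (nonlin3 p q) := by
  obtain ⟨C, -, hC⟩ := exists_gagliardo_nirenberg_const
  refine (((hC p G hp).1.add (hC q H hq).1).const_mul 2).mono' ?_ (ae_of_all _ fun x => ?_)
  · have h1 := hp.cont
    have h2 := hq.cont
    unfold nonlin3
    exact Continuous.aestronglyMeasurable (by fun_prop)
  · rw [nonlin3_eq, Real.norm_of_nonneg (sq_nonneg _)]
    simp only [Pi.add_apply]
    nlinarith [sq_nonneg (p x ^ 2 - q x ^ 2)]

/-- The sharp Gagliardo–Nirenberg inequality for weakly differentiable pairs. -/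
theorem WGrad.sharp_gagliardo_nirenberg {p q : Pt3 → ℝ} {G H : Fin 3 → Pt3 → ℝ} (hp : WGrad p G)
    (hq : WGrad q H) :
    ∫ x, nonlin3 p q x ≤ Real.sqrt (8 / (27 * mhat 1) *
      ((∑ i, ∫ x, G i x ^ 2) + ∑ i, ∫ x, H i x ^ 2) ^ 3
        * (((∫ x, p x ^ 2) + ∫ x, q x ^ 2) / 2)) := by
  have hm := mhat_one_pos
  obtain ⟨P, hPc, hPs, hPt, hPm, c, hc, hPg⟩ := hp.exists_approx
  obtain ⟨Q, hQc, hQs, hQt, hQm, d, hd, hQg⟩ := hq.exists_approx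
  have hP := fun n => H1R3.of_contDiff (hPc n) (hPs n)
  have hQ := fun n => H1R3.of_contDiff (hQc n) (hQs n)
  have h0 : ∀ (u v : Pt3 → ℝ) x, 0 ≤ nonlin3 u v x := fun u v x => by
    rw [nonlin3_eq]; positivity
  have key : ∀ n, ∫ x, nonlin3 (P n) (Q n) x ≤ Real.sqrt (8 / (27 * mhat 1) * (c n + d n) ^ 3
        * (((∫ x, p x ^ 2) + ∫ x, q x ^ 2) / 2)) := by
    intro n
    refine Real.le_sqrt_of_sq_le ?_
    have h1 := Waveguide.sharp_gagliardo_nirenberg (hP n) (hQ n)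
    rw [mul_comm, ← le_div_iff₀ hm] at h1
    refine h1.trans ?_
    have h2 : ∫ x, (gradSq3 (P n) x + gradSq3 (Q n) x) ≤ c n + d n := by
      rw [integral_add (hP n).memGrad (hQ n).memGrad]
      exact add_le_add (hPg n) (hQg n)
    have h3 := integral_gradSq3_nonneg (P n) (Q n)
    have h4 : ((∫ x, P n x ^ 2) + ∫ x, Q n x ^ 2) / 2 ≤ ((∫ x, p x ^ 2) + ∫ x, q x ^ 2) / 2 := by
      linarith [hPm n, hQm n]
    have h5 : 0 ≤ ((∫ x, P n x ^ 2) + ∫ x, Q n x ^ 2) / 2 := by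
      have : 0 ≤ ∫ x, P n x ^ 2 := integral_nonneg fun x => sq_nonneg _
      have : 0 ≤ ∫ x, Q n x ^ 2 := integral_nonneg fun x => sq_nonneg _
      positivity
    calc 8 / 27 * (∫ x, (gradSq3 (P n) x + gradSq3 (Q n) x)) ^ 3
          * (((∫ x, P n x ^ 2) + ∫ x, Q n x ^ 2) / 2) / mhat 1
        ≤ 8 / 27 * (c n + d n) ^ 3 * (((∫ x, p x ^ 2) + ∫ x, q x ^ 2) / 2) / mhat 1 := by
          refine div_le_div_of_nonneg_right (mul_le_mul (mul_le_mul_of_nonneg_left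
            (pow_le_pow_left₀ h3 h2 3) (by norm_num)) h4 h5 ?_) hm.le
          have := h3.trans h2
          positivity
      _ = _ := by field_simp
  have hlim : Tendsto (fun n => ENNReal.ofReal (Real.sqrt (8 / (27 * mhat 1) * (c n + d n) ^ 3
        * (((∫ x, p x ^ 2) + ∫ x, q x ^ 2) / 2)))) atTop (nhds (ENNReal.ofReal
          (Real.sqrt (8 / (27 * mhat 1) *
      ((∑ i, ∫ x, G i x ^ 2) + ∑ i, ∫ x, H i x ^ 2) ^ 3
        * (((∫ x, p x ^ 2) + ∫ x, q x ^ 2) / 2))))) :=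
    ENNReal.tendsto_ofReal (((((hc.add hd).pow 3).const_mul _).mul_const _).sqrt)
  rw [← ENNReal.ofReal_le_ofReal_iff (Real.sqrt_nonneg _), ← hlim.liminf_eq,
    ofReal_integral_eq_lintegral_ofReal (hp.integrable_nonlin3 hq) (ae_of_all _ (h0 p q))]
  have e1 : ∫⁻ x, ENNReal.ofReal (nonlin3 p q x)
      = ∫⁻ x, liminf (fun n => ENNReal.ofReal (nonlin3 (P n) (Q n) x)) atTop := by
    congr 1 with x
    refine (ENNReal.tendsto_ofReal (Tendsto.congr (fun n => (nonlin3_eq (P n) (Q n) x).symm)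
      ?_)).liminf_eq.symm
    rw [nonlin3_eq]
    exact (((hPt x).pow 2).add ((hQt x).pow 2)).pow 2
  rw [e1]
  have hmeas : ∀ n, Measurable fun x => ENNReal.ofReal (nonlin3 (P n) (Q n) x) := by
    intro n
    have h1 := (hPc n).continuous
    have h2 := (hQc n).continuous
    unfold nonlin3
    exact (Continuous.measurable (by fun_prop)).ennreal_ofReal
  refine (lintegral_liminf_le hmeas).trans (liminf_le_liminf (Eventually.of_forall fun n => ?_))
  rw [← ofReal_integral_eq_lintegral_ofReal ((hP n).integrable_nonlin3 (hQ n))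
    (ae_of_all _ (h0 _ _))]
  exact ENNReal.ofReal_le_ofReal (key n)

end SharpWeak

section MixedNorms

open scoped ENNReal

/-- Lebesgue measure on the fundamental interval of the circle. -/
abbrev circ : Measure ℝ := volume.restrict (Set.Ioc 0 (2 * π))

lemma restrict_dom : (volume : Measure Pt).restrict Dom = (volume : Measure Pt3).prod circ := by
  rw [Dom, Measure.volume_eq_prod, ← Measure.prod_restrict, Measure.restrict_univ]

lemma pow_rpow (a : ℝ≥0∞) (n : ℕ) {s : ℝ} (m : ℕ) (h : (n : ℝ) * s = m) :
    (a ^ n) ^ s = a ^ m := by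
  rw [← ENNReal.rpow_natCast, ← ENNReal.rpow_mul, h, ENNReal.rpow_natCast]

lemma lintegral_sq_mul_mul_le {f g k : Pt3 → ℝ≥0∞} (hf : Measurable f) (hg : Measurable g)
    (hk : Measurable k) :
    ∫⁻ x, f x ^ 2 * (g x * k x) ≤ (∫⁻ x, f x ^ 6) ^ (1 / 3 : ℝ) *
      (((∫⁻ x, g x ^ 6) ^ (1 / 3 : ℝ)) ^ (1 / 2 : ℝ) * (∫⁻ x, k x ^ 2) ^ (1 / 2 : ℝ)) := by
  have h1 := ENNReal.lintegral_mul_norm_pow_le (μ := volume) (f := fun x => f x ^ 4 * g x ^ 2)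
    (g := fun x => k x ^ 2) (by fun_prop) (by fun_prop)
    (p := 1 / 2) (q := 1 / 2) (by norm_num) (by norm_num) (by norm_num)
  have h2 := ENNReal.lintegral_mul_norm_pow_le (μ := volume) (f := fun x => f x ^ 6)
    (g := fun x => g x ^ 6) (by fun_prop) (by fun_prop)
    (p := 2 / 3) (q := 1 / 3) (by norm_num) (by norm_num) (by norm_num)
  have e1 : ∀ x, (f x ^ 4 * g x ^ 2) ^ (1 / 2 : ℝ) * (k x ^ 2) ^ (1 / 2 : ℝ)
      = f x ^ 2 * (g x * k x) := fun x => by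
    rw [ENNReal.mul_rpow_of_nonneg _ _ (by norm_num), pow_rpow _ 4 2 (by norm_num),
      pow_rpow (g x) 2 1 (by norm_num), pow_rpow (k x) 2 1 (by norm_num), pow_one, pow_one,
      mul_assoc]
  have e2 : ∀ x, (f x ^ 6) ^ (2 / 3 : ℝ) * (g x ^ 6) ^ (1 / 3 : ℝ) = f x ^ 4 * g x ^ 2 :=
    fun x => by rw [pow_rpow _ 6 4 (by norm_num), pow_rpow _ 6 2 (by norm_num)]
  simp only [e1] at h1
  simp only [e2] at h2
  refine h1.trans ?_
  rw [← mul_assoc]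
  refine mul_le_mul_left ?_ _
  refine (ENNReal.rpow_le_rpow h2 (by norm_num)).trans_eq ?_
  rw [ENNReal.mul_rpow_of_nonneg _ _ (by norm_num), ← ENNReal.rpow_mul]
  norm_num

/-- The square of the mixed norm `L²_y L⁶_x`. -/
def mixedSq (r : Pt → ℝ≥0∞) : ℝ≥0∞ :=
  ∫⁻ y, (∫⁻ x : Pt3, r (x, y) ^ 6) ^ (1 / 3 : ℝ) ∂circ

lemma lintegral_cross_le {p : Pt3 → ℝ≥0∞} {r k : Pt → ℝ≥0∞} (hp : Measurable p)
    (hr : Measurable r) (hk : Measurable k) :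
    ∫⁻ z, p z.1 ^ 2 * (r z * k z) ∂((volume : Measure Pt3).prod circ)
      ≤ (∫⁻ x, p x ^ 6) ^ (1 / 3 : ℝ) * (mixedSq r ^ (1 / 2 : ℝ) *
        (∫⁻ z, k z ^ 2 ∂((volume : Measure Pt3).prod circ)) ^ (1 / 2 : ℝ)) := by
  rw [lintegral_prod_symm' _ (by fun_prop), lintegral_prod_symm' (fun z => k z ^ 2) (by fun_prop)]
  have m1 : Measurable fun y => ∫⁻ x : Pt3, r (x, y) ^ 6 :=
    Measurable.lintegral_prod_left' (f := fun z => r z ^ 6) (by fun_prop)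
  have m2 : Measurable fun y => ∫⁻ x : Pt3, k (x, y) ^ 2 :=
    Measurable.lintegral_prod_left' (f := fun z => k z ^ 2) (by fun_prop)
  refine (lintegral_mono fun y => lintegral_sq_mul_mul_le hp
    (hr.comp measurable_prodMk_right) (hk.comp measurable_prodMk_right)).trans ?_
  rw [lintegral_const_mul _ (by fun_prop)]
  refine mul_le_mul_right ?_ _
  exact ENNReal.lintegral_mul_norm_pow_le (μ := circ) (m1.pow_const _).aemeasurable
    m2.aemeasurable (by norm_num) (by norm_num) (by norm_num)

lemma lintegral_quartic_le {r k : Pt → ℝ≥0∞} (hr : Measurable r) (hk : Measurable k)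
    (h : ∀ᵐ x : Pt3, ∀ y ∈ Set.Ioc 0 (2 * π), r (x, y) ^ 2 ≤ ∫⁻ t, r (x, t) * k (x, t) ∂circ) :
    ∫⁻ z, r z ^ 4 ∂((volume : Measure Pt3).prod circ)
      ≤ mixedSq r * (mixedSq r ^ (1 / 2 : ℝ) *
        (∫⁻ z, k z ^ 2 ∂((volume : Measure Pt3).prod circ)) ^ (1 / 2 : ℝ)) := by
  rw [lintegral_prod_symm' _ (by fun_prop)]
  have m1 : Measurable fun y => ∫⁻ x : Pt3, r (x, y) ^ 6 :=
    Measurable.lintegral_prod_left' (f := fun z => r z ^ 6) (by fun_prop)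
  conv_rhs => rw [mixedSq, ← lintegral_mul_const _ (by fun_prop)]
  refine lintegral_mono_ae ((ae_restrict_mem measurableSet_Ioc).mono fun y hy => ?_)
  refine le_trans ?_ (lintegral_cross_le (hr.comp measurable_prodMk_right) hr hk)
  rw [lintegral_prod _ (by fun_prop)]
  refine lintegral_mono_ae (h.mono fun x hx => ?_)
  dsimp only [Function.comp]
  rw [lintegral_const_mul _ (by fun_prop), show 4 = 2 + 2 from rfl, pow_add]
  exact mul_le_mul_right (hx y hy) _

end MixedNorms

section Average

lemma integrable_mul_of_memLp {α : Type*} [MeasurableSpace α] {μ : Measure α} {f g : α → ℝ}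
    (hf : MemLp f 2 μ) (hg : MemLp g 2 μ) : Integrable (fun x => f x * g x) μ :=
  hf.integrable_mul hg

/-- The average of a function over the circle variable. -/
def avg (f : Pt → ℝ) (x : Pt3) : ℝ := (2 * π)⁻¹ * ∫ y, f (x, y) ∂circ

lemma circ_univ : circ Set.univ = ENNReal.ofReal (2 * π) := by simp [circ]

lemma circ_real_univ : circ.real Set.univ = 2 * π := by
  rw [Measure.real, circ_univ, ENNReal.toReal_ofReal (by positivity)]

lemma measurable_avg {f : Pt → ℝ} (hf : Measurable f) : Measurable (avg f) :=
  (hf.stronglyMeasurable.integral_prod_right').measurable.const_mul _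

lemma memLp_comp_fst {w : Pt3 → ℝ} {p : ENNReal} (hw : MemLp w p) :
    MemLp (fun z : Pt => w z.1) p ((volume : Measure Pt3).prod circ) := by
  refine MemLp.comp_of_map (f := Prod.fst) ?_ measurable_fst.aemeasurable
  rw [Measure.map_fst_prod]
  exact hw.smul_measure (measure_ne_top _ _)

lemma integral_comp_fst (w : Pt3 → ℝ) :
    ∫ z : Pt, w z.1 ∂((volume : Measure Pt3).prod circ) = 2 * π * ∫ x, w x := by
  rw [integral_fun_fst, circ_real_univ, smul_eq_mul]

lemma integral_eq_avg (f : Pt → ℝ) (x : Pt3) : ∫ y, f (x, y) ∂circ = 2 * π * avg f x := by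
  rw [avg]
  field_simp

lemma integral_mul_comp_fst {f : Pt → ℝ} {w : Pt3 → ℝ}
    (h : Integrable (fun z : Pt => f z * w z.1) ((volume : Measure Pt3).prod circ)) :
    ∫ z : Pt, f z * w z.1 ∂((volume : Measure Pt3).prod circ) = 2 * π * ∫ x, avg f x * w x := by
  rw [integral_prod _ h, ← integral_const_mul]
  refine integral_congr_ae (ae_of_all _ fun x => ?_)
  dsimp only
  rw [integral_mul_const, integral_eq_avg]
  ring

lemma memLp_avg {f : Pt → ℝ} (hf : Measurable f)
    (h2 : MemLp f 2 ((volume : Measure Pt3).prod circ)) : MemLp (avg f) 2 := by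
  refine memLp_two_of_lintegral_lt_top (measurable_avg hf).aestronglyMeasurable ?_
  have hpt : ∀ x, ‖avg f x‖ₑ ^ 2
      ≤ ‖(2 * π)⁻¹‖ₑ ^ 2 * ((∫⁻ y, ‖f (x, y)‖ₑ ^ 2 ∂circ) * circ Set.univ) := by
    intro x
    rw [avg, enorm_mul, mul_pow]
    refine mul_le_mul_right ?_ _
    refine (pow_le_pow_left' (enorm_integral_le_lintegral_enorm _) 2).trans ?_
    have := lintegral_mul_sq_le (μ := circ) (f := fun y => ‖f (x, y)‖ₑ) (g := fun _ => 1)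
      (hf.comp measurable_prodMk_left).enorm.aemeasurable aemeasurable_const
    simpa using this
  refine (lintegral_mono hpt).trans_lt ?_
  have hm : Measurable fun z => ‖f z‖ₑ ^ 2 := by fun_prop
  rw [lintegral_const_mul _ (hm.lintegral_prod_right'.mul_const _),
    lintegral_mul_const _ hm.lintegral_prod_right',
    ← lintegral_prod (fun z => ‖f z‖ₑ ^ 2) hm.aemeasurable, lintegral_enorm_sq_eq h2]
  exact ENNReal.mul_lt_top (ENNReal.pow_lt_top enorm_lt_top) (ENNReal.mul_lt_top ENNReal.ofReal_lt_top (measure_lt_top _ _))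

lemma integral_sub_avg_sq {f : Pt → ℝ} (hf : Measurable f)
    (h2 : MemLp f 2 ((volume : Measure Pt3).prod circ)) :
    ∫ z : Pt, (f z - avg f z.1) ^ 2 ∂((volume : Measure Pt3).prod circ)
      = (∫ z, f z ^ 2 ∂((volume : Measure Pt3).prod circ)) - 2 * π * ∫ x, avg f x ^ 2 := by
  have ha := memLp_avg hf h2
  have ha' := memLp_comp_fst ha
  have hi := integrable_mul_of_memLp h2 ha'
  have h1 : ∀ z : Pt, (f z - avg f z.1) ^ 2
      = (f z ^ 2 - 2 * (f z * avg f z.1)) + avg f z.1 ^ 2 := fun z => by ring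
  simp only [h1]
  rw [integral_add (f := fun z => f z ^ 2 - 2 * (f z * avg f z.1))
      (h2.integrable_sq.sub (hi.const_mul 2)) ha'.integrable_sq,
    integral_sub h2.integrable_sq (hi.const_mul 2), integral_const_mul,
    integral_mul_comp_fst (w := avg f) hi, integral_comp_fst fun x => avg f x ^ 2]
  simp only [← sq]
  ring

end Average

section Slices

variable {u : Pt → ℝ}

lemma measurable_gradx (u : Pt → ℝ) (i : Fin 3) : Measurable fun z => gradx u z i :=
  measurable_fderiv_apply_const ℝ u (ex i)

lemma measurable_grady (u : Pt → ℝ) : Measurable (grady u) :=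
  measurable_fderiv_apply_const ℝ u ey

lemma gradSqX_nonneg (u : Pt → ℝ) (z : Pt) : 0 ≤ gradSqX u z :=
  Finset.sum_nonneg fun _ _ => sq_nonneg _

lemma measurable_gradSqX (u : Pt → ℝ) : Measurable (gradSqX u) :=
  Finset.measurable_sum _ fun i _ => (measurable_gradx u i).pow_const 2

lemma H1.integrable_gradSqX (h : H1 u) : IntegrableOn (gradSqX u) Dom := by
  refine h.memGrad.mono' (measurable_gradSqX u).aestronglyMeasurable (ae_of_all _ fun z => ?_)
  rw [Real.norm_of_nonneg (gradSqX_nonneg u z), gradSq]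
  exact le_add_of_nonneg_right (sq_nonneg _)

lemma H1.integrable_grady_sq (h : H1 u) : IntegrableOn (fun z => grady u z ^ 2) Dom := by
  refine h.memGrad.mono' ((measurable_grady u).pow_const 2).aestronglyMeasurable
    (ae_of_all _ fun z => ?_)
  rw [Real.norm_of_nonneg (sq_nonneg _), gradSq]
  exact le_add_of_nonneg_left (gradSqX_nonneg u z)

lemma H1.measurable (h : H1 u) : Measurable u := h.diff.continuous.measurable

lemma H1.memLp (h : H1 u) : MemLp u 2 ((volume : Measure Pt3).prod circ) := by
  rw [← restrict_dom]
  exact memLp_two_of_integrable_sq h.measurable h.memL2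

lemma H1.memLp_gradx (h : H1 u) (i : Fin 3) :
    MemLp (fun z => gradx u z i) 2 ((volume : Measure Pt3).prod circ) := by
  rw [← restrict_dom]
  refine memLp_two_of_integrable_sq (measurable_gradx u i) ?_
  refine h.integrable_gradSqX.mono' ((measurable_gradx u i).pow_const 2).aestronglyMeasurable
    (ae_of_all _ fun z => ?_)
  rw [Real.norm_of_nonneg (sq_nonneg _)]
  exact Finset.single_le_sum (f := fun i => gradx u z i ^ 2) (fun i _ => sq_nonneg _)
    (Finset.mem_univ i)

lemma H1.memLp_grady (h : H1 u) : MemLp (grady u) 2 ((volume : Measure Pt3).prod circ) := by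
  rw [← restrict_dom]
  exact memLp_two_of_integrable_sq (measurable_grady u) h.integrable_grady_sq

lemma H1.integral_gradSqX (h : H1 u) : ∫ z in Dom, gradSqX u z
    = ∑ i, ∫ z, gradx u z i ^ 2 ∂((volume : Measure Pt3).prod circ) := by
  rw [restrict_dom]
  exact integral_finsetSum _ (f := fun i z => gradx u z i ^ 2)
    fun i _ => (h.memLp_gradx i).integrable_sq

lemma hasFDerivAt_slice (hu : Differentiable ℝ u) (x : Pt3) (y : ℝ) :
    HasFDerivAt (fun x => u (x, y)) ((fderiv ℝ u (x, y)).comp (.inl ℝ Pt3 ℝ)) x :=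
  (hu (x, y)).hasFDerivAt.comp x (hasFDerivAt_prodMk_left x y)

lemma grad3_slice (hu : Differentiable ℝ u) (x : Pt3) (y : ℝ) (i : Fin 3) :
    grad3 (fun x => u (x, y)) x i = gradx u (x, y) i := by
  rw [grad3, (hasFDerivAt_slice hu x y).fderiv]
  rfl

lemma hasDerivAt_slice (hu : Differentiable ℝ u) (x : Pt3) (y : ℝ) :
    HasDerivAt (fun y => u (x, y)) (grady u (x, y)) y := by
  have := ((hu (x, y)).hasFDerivAt.comp y (hasFDerivAt_prodMk_right x y)).hasDerivAt
  exact this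

lemma H1.ae_wgrad_slice (h : H1 u) :
    ∀ᵐ y ∂circ, WGrad (fun x => u (x, y)) fun i x => gradx u (x, y) i := by
  have h1 := h.memLp.integrable_sq.prod_left_ae
  have h2 : ∀ᵐ y ∂circ, ∀ i, Integrable (fun x => gradx u (x, y) i ^ 2) :=
    ae_all_iff.2 fun i => (h.memLp_gradx i).integrable_sq.prod_left_ae
  filter_upwards [h1, h2] with y hy1 hy2
  have hd : Differentiable ℝ fun x => u (x, y) := fun x =>
    (hasFDerivAt_slice h.diff x y).differentiableAt
  have := wgrad_of_differentiable hd (memLp_two_of_integrable_sq hd.continuous.measurable hy1)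
    fun i => by
      simp only [grad3_slice h.diff]
      exact memLp_two_of_integrable_sq ((measurable_gradx u i).comp measurable_prodMk_right) (hy2 i)
  simpa only [grad3_slice h.diff] using this

lemma H1.continuous_avg (h : H1 u) : Continuous (avg u) := by
  unfold avg
  simp only [circ, ← intervalIntegral.integral_of_le (by positivity : (0 : ℝ) ≤ 2 * π)]
  exact (intervalIntegral.continuous_parametric_intervalIntegral_of_continuous'
    (f := fun x y => u (x, y)) h.diff.continuous 0 (2 * π)).const_mul _

lemma contDiff_memLp {φ : Pt3 → ℝ} (hφ : ContDiff ℝ (⊤ : ℕ∞) φ) (hφs : HasCompactSupport φ) :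
    MemLp φ 2 volume ∧ ∀ i, MemLp (fun x => grad3 φ x i) 2 volume := by
  have h := H1R3.of_contDiff hφ hφs
  exact ⟨h.memLp, h.memLp_grad⟩

lemma H1.wgrad_avg (h : H1 u) : WGrad (avg u) fun i => avg fun z => gradx u z i where
  cont := h.continuous_avg
  memLp := memLp_avg h.measurable h.memLp
  measGrad i := measurable_avg (measurable_gradx u i)
  memGrad i := memLp_avg (measurable_gradx u i) (h.memLp_gradx i)
  weak φ hφ hφs i := by
    obtain ⟨h1, h2⟩ := contDiff_memLp hφ hφs
    have i1 := integrable_mul_of_memLp h.memLp (memLp_comp_fst (h2 i))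
    have i2 := integrable_mul_of_memLp (h.memLp_gradx i) (memLp_comp_fst h1)
    have e1 := integral_mul_comp_fst (w := fun x => grad3 φ x i) i1
    have e2 := integral_mul_comp_fst (w := φ) i2
    have hpi : 2 * π ≠ 0 := by positivity
    refine mul_left_cancel₀ hpi ?_
    rw [← e1, mul_neg, ← e2, integral_prod_symm _ i1, integral_prod_symm _ i2, ← integral_neg]
    refine integral_congr_ae ?_
    filter_upwards [h.ae_wgrad_slice] with y hy
    exact hy.weak φ hφ hφs i

lemma WGrad.sub {p q : Pt3 → ℝ} {G H : Fin 3 → Pt3 → ℝ} (hp : WGrad p G) (hq : WGrad q H) :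
    WGrad (fun x => p x - q x) fun i x => G i x - H i x where
  cont := hp.cont.sub hq.cont
  memLp := hp.memLp.sub hq.memLp
  measGrad i := (hp.measGrad i).sub (hq.measGrad i)
  memGrad i := (hp.memGrad i).sub (hq.memGrad i)
  weak φ hφ hφs i := by
    obtain ⟨h1, h2⟩ := contDiff_memLp hφ hφs
    simp only [sub_mul]
    rw [integral_sub (integrable_mul_of_memLp hp.memLp (h2 i))
        (integrable_mul_of_memLp hq.memLp (h2 i)),
      integral_sub (integrable_mul_of_memLp (hp.memGrad i) h1)
        (integrable_mul_of_memLp (hq.memGrad i) h1),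
      hp.weak φ hφ hφs i, hq.weak φ hφ hφs i]
    ring

end Slices

section CircleInequalities

variable {f f' : ℝ → ℝ}

lemma abs_sub_le_integral_circ (hf : ∀ y, HasDerivAt f (f' y) y) (hi : Integrable f' circ)
    {y t : ℝ} (hy : y ∈ Set.Ioc 0 (2 * π)) (ht : t ∈ Set.Ioc 0 (2 * π)) :
    |f y - f t| ≤ ∫ s, |f' s| ∂circ := by
  have hsub : Set.uIoc t y ⊆ Set.Ioc 0 (2 * π) := fun s hs =>
    ⟨(le_min ht.1.le hy.1.le).trans_lt hs.1, hs.2.trans (max_le ht.2 hy.2)⟩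
  have hii : IntervalIntegrable f' volume t y :=
    intervalIntegrable_iff.2 (IntegrableOn.mono_set hi hsub)
  rw [← intervalIntegral.integral_eq_sub_of_hasDerivAt (fun s _ => hf s) hii]
  refine (intervalIntegral.norm_integral_le_integral_norm_uIoc (f := f') (μ := volume)).trans ?_
  exact setIntegral_mono_set hi.norm (ae_of_all _ fun s => norm_nonneg _) hsub.eventuallyLE

lemma memLp_circ_of_continuous (hf : Continuous f) : MemLp f 2 circ :=
  memLp_two_of_integrable_sq hf.measurable (hf.pow 2).integrableOn_Ioc

lemma abs_sub_average_le (hf : ∀ y, HasDerivAt f (f' y) y) (hi : Integrable f' circ)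
    {y : ℝ} (hy : y ∈ Set.Ioc 0 (2 * π)) :
    |f y - (2 * π)⁻¹ * ∫ t, f t ∂circ| ≤ ∫ s, |f' s| ∂circ := by
  have hc : Continuous f := continuous_iff_continuousAt.2 fun y => (hf y).continuousAt
  have hp : 0 < 2 * π := by positivity
  have e : f y - (2 * π)⁻¹ * ∫ t, f t ∂circ = (2 * π)⁻¹ * ∫ t, (f y - f t) ∂circ := by
    rw [integral_sub (integrable_const _) hc.integrableOn_Ioc, integral_const, circ_real_univ,
      smul_eq_mul]
    field_simp
  rw [e, abs_mul, abs_of_pos (inv_pos.2 hp), inv_mul_le_iff₀ hp, mul_comm]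
  have := norm_setIntegral_le_of_norm_le_const (μ := volume) (s := Set.Ioc 0 (2 * π))
    (f := fun t => f y - f t) (C := ∫ s, |f' s| ∂circ) measure_Ioc_lt_top
    fun t ht => abs_sub_le_integral_circ hf hi hy ht
  rwa [Measure.real, Real.volume_Ioc, sub_zero, ENNReal.toReal_ofReal hp.le] at this

lemma sq_le_integral_circ (hf : ∀ y, HasDerivAt f (f' y) y) (h2 : MemLp f' 2 circ)
    {y : ℝ} (hy : y ∈ Set.Ioc 0 (2 * π)) :
    f y ^ 2 ≤ ∫ t, |f t| * (|f t| + 2 * |f' t|) ∂circ := by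
  have hc : Continuous f := continuous_iff_continuousAt.2 fun y => (hf y).continuousAt
  have hi : Integrable (fun t => f t * f' t) circ :=
    integrable_mul_of_memLp (memLp_circ_of_continuous hc) h2
  have hd : ∀ t, HasDerivAt (fun t => f t ^ 2) (2 * (f t * f' t)) t := fun t => by
    have := (hf t).fun_pow 2
    simpa [mul_assoc] using this
  have hs : Integrable (fun t => f t ^ 2) circ := (hc.pow 2).integrableOn_Ioc
  have hJ : Integrable (fun t => |f t| * (2 * |f' t|)) circ := by
    refine (hi.norm.const_mul 2).congr (ae_of_all _ fun t => ?_)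
    simp only [norm_mul, Real.norm_eq_abs]
    ring
  have h1 : ∀ t ∈ Set.Ioc 0 (2 * π), f y ^ 2 - (∫ s, |f s| * (2 * |f' s|) ∂circ) ≤ f t ^ 2 := by
    intro t ht
    have := abs_sub_le_integral_circ hd (hi.const_mul 2) hy ht
    have h3 := (le_abs_self _).trans this
    have e : ∀ s, |2 * (f s * f' s)| = |f s| * (2 * |f' s|) := fun s => by
      rw [abs_mul, abs_mul, abs_two]; ring
    simp only [e] at h3
    linarith
  have h3 := setIntegral_mono_on (μ := volume) (integrable_const (μ := circ) _) hs
    measurableSet_Ioc h1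
  rw [setIntegral_const, Measure.real, Real.volume_Ioc, sub_zero,
    ENNReal.toReal_ofReal (by positivity), smul_eq_mul] at h3
  have e : ∫ t, |f t| * (|f t| + 2 * |f' t|) ∂circ
      = (∫ t, f t ^ 2 ∂circ) + ∫ t, |f t| * (2 * |f' t|) ∂circ := by
    rw [← integral_add hs hJ]
    refine integral_congr_ae (ae_of_all _ fun t => ?_)
    dsimp only
    rw [mul_add, abs_mul_abs_self, sq]
  rw [e]
  have h5 : 0 ≤ ∫ t, f t ^ 2 ∂circ := integral_nonneg fun _ => sq_nonneg _
  have h6 : 1 ≤ 2 * π := by linarith [pi_gt_three]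
  by_contra! hcon
  have h7 : 0 < f y ^ 2 - (∫ s, |f s| * (2 * |f' s|) ∂circ) := by linarith
  have := mul_le_mul_of_nonneg_right h6 h7.le
  linarith

end CircleInequalities

section Oscillation

variable {u : Pt → ℝ}

/-- The part of `u` with zero average over the circle. -/
def osc (u : Pt → ℝ) (z : Pt) : ℝ := u z - avg u z.1

/-- The `∇_x`-energy of the oscillation of `u`. -/
def gap (u : Pt → ℝ) : ℝ :=
  ∑ i, ∫ z : Pt, (gradx u z i - avg (fun z => gradx u z i) z.1) ^ 2
    ∂((volume : Measure Pt3).prod circ)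

/-- The `∇_x`-energy of the average of `u`. -/
def gradAvg (u : Pt → ℝ) : ℝ := ∑ i, ∫ x, avg (fun z => gradx u z i) x ^ 2

lemma gap_nonneg (u : Pt → ℝ) : 0 ≤ gap u :=
  Finset.sum_nonneg fun _ _ => integral_nonneg fun _ => sq_nonneg _

lemma gradAvg_nonneg (u : Pt → ℝ) : 0 ≤ gradAvg u :=
  Finset.sum_nonneg fun _ _ => integral_nonneg fun _ => sq_nonneg _

lemma H1.gap_eq (h : H1 u) : gap u = (∫ z in Dom, gradSqX u z) - 2 * π * gradAvg u := by
  rw [gap, gradAvg, h.integral_gradSqX, Finset.mul_sum, ← Finset.sum_sub_distrib]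
  exact Finset.sum_congr rfl fun i _ =>
    integral_sub_avg_sq (measurable_gradx u i) (h.memLp_gradx i)

lemma H1.measurable_osc (h : H1 u) : Measurable (osc u) :=
  h.measurable.sub ((measurable_avg h.measurable).comp measurable_fst)

lemma hasDerivAt_osc (hu : Differentiable ℝ u) (x : Pt3) (y : ℝ) :
    HasDerivAt (fun y => osc u (x, y)) (grady u (x, y)) y :=
  (hasDerivAt_slice hu x y).sub_const (avg u x)

lemma exists_mixedSq_osc_const : ∃ C : ℝ, 0 ≤ C ∧ ∀ u, H1 u →
    mixedSq (fun z => ‖osc u z‖ₑ) ≤ ENNReal.ofReal (C * gap u) := by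
  obtain ⟨C, hC, hS⟩ := exists_sobolev_const
  refine ⟨C + 1, by linarith, fun u h => ?_⟩
  have hL : ∀ i, MemLp (fun z : Pt => gradx u z i - avg (fun z => gradx u z i) z.1) 2
      ((volume : Measure Pt3).prod circ) := fun i =>
    (h.memLp_gradx i).sub (memLp_comp_fst (memLp_avg (measurable_gradx u i) (h.memLp_gradx i)))
  have e : gap u = ∫ y, ∑ i, (∫ x : Pt3, (gradx u (x, y) i - avg (fun z => gradx u z i) x) ^ 2) ∂circ := by
    rw [gap, integral_finsetSum Finset.univ (f := fun i y =>
      ∫ x : Pt3, (gradx u (x, y) i - avg (fun z => gradx u z i) x) ^ 2)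
      fun i _ => (hL i).integrable_sq.integral_prod_right]
    exact Finset.sum_congr rfl fun i _ => integral_prod_symm _ (hL i).integrable_sq
  rw [mixedSq, e, ← integral_const_mul, ofReal_integral_eq_lintegral_ofReal]
  · refine lintegral_mono_ae ?_
    filter_upwards [h.ae_wgrad_slice] with y hy
    have h1 := hS _ _ (hy.sub h.wgrad_avg)
    set s := ∑ i, ∫ x, (gradx u (x, y) i - avg (fun z => gradx u z i) x) ^ 2
    have hs : 0 ≤ s := Finset.sum_nonneg fun _ _ => integral_nonneg fun _ => sq_nonneg _
    have h2 : C * s ^ 3 ≤ ((C + 1) * s) ^ 3 := by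
      rw [mul_pow]
      refine mul_le_mul_of_nonneg_right ?_ (by positivity)
      nlinarith [sq_nonneg C, mul_nonneg hC (sq_nonneg C)]
    refine (ENNReal.rpow_le_rpow (h1.trans (ENNReal.ofReal_le_ofReal h2)) (by norm_num)).trans_eq ?_
    rw [ENNReal.ofReal_pow (by positivity), pow_rpow _ 3 1 (by norm_num), pow_one]
  · exact (integrable_finsetSum _ fun i _ =>
      (hL i).integrable_sq.integral_prod_right).const_mul _
  · exact ae_of_all _ fun y => mul_nonneg (by linarith)
      (Finset.sum_nonneg fun _ _ => integral_nonneg fun _ => sq_nonneg _)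

lemma H1.ae_memLp_grady_slice (h : H1 u) :
    ∀ᵐ x : Pt3, MemLp (fun y => grady u (x, y)) 2 circ := by
  filter_upwards [h.memLp_grady.integrable_sq.prod_right_ae] with x hx
  exact memLp_two_of_integrable_sq ((measurable_grady u).comp measurable_prodMk_left) hx

lemma H1.osc_poincare (h : H1 u) :
    ∫⁻ z, ‖osc u z‖ₑ ^ 2 ∂((volume : Measure Pt3).prod circ)
      ≤ ENNReal.ofReal (4 * π ^ 2 * ∫ z in Dom, grady u z ^ 2) := by
  have hm : Measurable fun z => ‖grady u z‖ₑ ^ 2 := (measurable_grady u).enorm.pow_const 2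
  have h1 : ∀ᵐ x : Pt3, ∀ y ∈ Set.Ioc 0 (2 * π),
      ‖osc u (x, y)‖ₑ ^ 2 ≤ (∫⁻ t, ‖grady u (x, t)‖ₑ ^ 2 ∂circ) * ENNReal.ofReal (2 * π) := by
    filter_upwards [h.ae_memLp_grady_slice] with x hx y hy
    have hi : Integrable (fun y => grady u (x, y)) circ := hx.integrable (by norm_num)
    have h2 := abs_sub_average_le (hasDerivAt_slice h.diff x) hi hy
    have h3 : ‖osc u (x, y)‖ₑ ≤ ∫⁻ t, ‖grady u (x, t)‖ₑ * 1 ∂circ := by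
      simp only [mul_one]
      rw [← ofReal_integral_norm_eq_lintegral_enorm hi, Real.enorm_eq_ofReal_abs]
      exact ENNReal.ofReal_le_ofReal h2
    refine (pow_le_pow_left' h3 2).trans ((lintegral_mul_sq_le
      ((measurable_grady u).comp measurable_prodMk_left).enorm.aemeasurable
      aemeasurable_const).trans_eq ?_)
    simp only [one_pow, lintegral_one, circ_univ, Function.comp]
  rw [lintegral_prod _ (h.measurable_osc.enorm.pow_const 2).aemeasurable]
  refine (lintegral_mono_ae (h1.mono fun x hx => setLIntegral_mono' measurableSet_Ioc hx)).trans ?_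
  simp only [lintegral_const, circ_univ]
  rw [lintegral_mul_const _ (by fun_prop), lintegral_mul_const _ hm.lintegral_prod_right',
    ← lintegral_prod _ hm.aemeasurable, lintegral_enorm_sq_eq h.memLp_grady, restrict_dom,
    ← ENNReal.ofReal_mul (integral_nonneg fun _ => sq_nonneg _), ← ENNReal.ofReal_mul
      (mul_nonneg (integral_nonneg fun _ => sq_nonneg _) (by positivity))]
  exact le_of_eq (by congr 1; ring)

/-- The integrand controlling the square of the oscillation. -/
def oscMajorant (u : Pt → ℝ) (z : Pt) : ℝ := |osc u z| + 2 * |grady u z|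

lemma H1.ae_osc_sq_le (h : H1 u) : ∀ᵐ x : Pt3, ∀ y ∈ Set.Ioc 0 (2 * π),
    ‖osc u (x, y)‖ₑ ^ 2 ≤ ∫⁻ t, ‖osc u (x, t)‖ₑ * ‖oscMajorant u (x, t)‖ₑ ∂circ := by
  filter_upwards [h.ae_memLp_grady_slice] with x hx y hy
  have h1 := sq_le_integral_circ (hasDerivAt_osc h.diff x) hx hy
  rw [enorm_sq_eq]
  refine (ENNReal.ofReal_le_ofReal h1).trans ?_
  refine (ENNReal.ofReal_le_ofReal (le_abs_self _)).trans ?_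
  rw [← Real.enorm_eq_ofReal_abs]
  refine (enorm_integral_le_lintegral_enorm _).trans_eq (lintegral_congr fun t => ?_)
  rw [enorm_mul, enorm_abs, oscMajorant]

lemma H1.measurable_oscMajorant (h : H1 u) : Measurable (oscMajorant u) := by
  have := h.measurable_osc
  have := measurable_grady u
  unfold oscMajorant
  exact Measurable.add (measurable_norm.comp h.measurable_osc)
    ((measurable_norm.comp (measurable_grady u)).const_mul 2)

lemma H1.lintegral_oscMajorant_sq_le (h : H1 u) :
    ∫⁻ z, ‖oscMajorant u z‖ₑ ^ 2 ∂((volume : Measure Pt3).prod circ)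
      ≤ ENNReal.ofReal (8 * (π ^ 2 + 1) * ∫ z in Dom, grady u z ^ 2) := by
  have hD : 0 ≤ ∫ z in Dom, grady u z ^ 2 := integral_nonneg fun _ => sq_nonneg _
  have h1 : ∀ z, ‖oscMajorant u z‖ₑ ^ 2 ≤ 2 * ‖osc u z‖ₑ ^ 2 + 8 * ‖grady u z‖ₑ ^ 2 := by
    intro z
    rw [enorm_sq_eq, enorm_sq_eq, enorm_sq_eq, ← ENNReal.ofReal_ofNat 2, ← ENNReal.ofReal_ofNat 8,
      ← ENNReal.ofReal_mul (by norm_num), ← ENNReal.ofReal_mul (by norm_num),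
      ← ENNReal.ofReal_add (by positivity) (by positivity), oscMajorant]
    refine ENNReal.ofReal_le_ofReal ?_
    rw [← sq_abs (osc u z), ← sq_abs (grady u z)]
    nlinarith [sq_nonneg (|osc u z| - 2 * |grady u z|)]
  refine (lintegral_mono h1).trans ?_
  rw [lintegral_add_left ((h.measurable_osc.enorm.pow_const 2).const_mul _),
    lintegral_const_mul _ (h.measurable_osc.enorm.pow_const 2),
    lintegral_const_mul _ ((measurable_grady u).enorm.pow_const 2),
    lintegral_enorm_sq_eq h.memLp_grady]
  refine (add_le_add_left (mul_le_mul_right h.osc_poincare 2) _).trans ?_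
  rw [← restrict_dom, ← ENNReal.ofReal_ofNat 2, ← ENNReal.ofReal_ofNat 8,
    ← ENNReal.ofReal_mul (by norm_num), ← ENNReal.ofReal_mul (by norm_num),
    ← ENNReal.ofReal_add (by positivity) (by positivity)]
  exact ENNReal.ofReal_le_ofReal (le_of_eq (by ring))

end Oscillation

section Interaction

open scoped ENNReal

variable {u v : Pt → ℝ}

/-- The `y`-energy `∫ |u_y|²`. -/
def enY (u : Pt → ℝ) : ℝ := ∫ z in Dom, grady u z ^ 2

lemma enY_nonneg (u : Pt → ℝ) : 0 ≤ enY u := integral_nonneg fun _ => sq_nonneg _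

lemma rpow_half_le {t : ℝ≥0∞} {s : ℝ} (hs : 0 ≤ s) (h : t ≤ ENNReal.ofReal s) :
    t ^ (1 / 2 : ℝ) ≤ ENNReal.ofReal (Real.sqrt s) := by
  rw [Real.sqrt_eq_rpow, ← ENNReal.ofReal_rpow_of_nonneg hs (by norm_num)]
  exact ENNReal.rpow_le_rpow h (by norm_num)

lemma enorm_pow_four_eq (a : ℝ) : ‖a‖ₑ ^ 4 = ENNReal.ofReal (a ^ 4) := by
  rw [show 4 = 2 * 2 from rfl, pow_mul, pow_mul, enorm_sq_eq, ENNReal.ofReal_pow (sq_nonneg _)]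

lemma integrable_and_integral_le_of_lintegral_le {α : Type*} [MeasurableSpace α] {μ : Measure α}
    {f : α → ℝ} (hf : Measurable f) (h0 : ∀ x, 0 ≤ f x) {c : ℝ} (hc : 0 ≤ c)
    (h : ∫⁻ x, ENNReal.ofReal (f x) ∂μ ≤ ENNReal.ofReal c) :
    Integrable f μ ∧ ∫ x, f x ∂μ ≤ c := by
  have hi : Integrable f μ := by
    refine ⟨hf.aestronglyMeasurable, ?_⟩
    rw [hasFiniteIntegral_iff_ofReal (ae_of_all _ h0)]
    exact h.trans_lt ENNReal.ofReal_lt_top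
  refine ⟨hi, ?_⟩
  rw [← ofReal_integral_eq_lintegral_ofReal hi (ae_of_all _ h0)] at h
  exact (ENNReal.ofReal_le_ofReal_iff hc).1 h

lemma exists_cross_const : ∃ C : ℝ, 0 ≤ C ∧ ∀ u v, H1 u → H1 v →
    Integrable (fun z : Pt => avg u z.1 ^ 2 * osc v z ^ 2) ((volume : Measure Pt3).prod circ) ∧
    ∫ z : Pt, avg u z.1 ^ 2 * osc v z ^ 2 ∂((volume : Measure Pt3).prod circ)
      ≤ C * gradAvg u * Real.sqrt (gap v * enY v) := by
  obtain ⟨C, hC, hS⟩ := exists_sobolev_const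
  obtain ⟨C₁, hC₁, hM⟩ := exists_mixedSq_osc_const
  refine ⟨(C + 1) * Real.sqrt (C₁ * (4 * π ^ 2)), by positivity, fun u v hu hv => ?_⟩
  have hg := gap_nonneg v
  have hD := enY_nonneg v
  have hX := gradAvg_nonneg u
  have ha := measurable_avg hu.measurable
  have ho := hv.measurable_osc
  refine integrable_and_integral_le_of_lintegral_le (by fun_prop) (fun z => by positivity)
    (by positivity) ?_
  have h1 := lintegral_cross_le (p := fun x => ‖avg u x‖ₑ) (r := fun z => ‖osc v z‖ₑ)
    (k := fun z => ‖osc v z‖ₑ) ha.enorm ho.enorm ho.enorm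
  have e1 : ∀ z : Pt, ENNReal.ofReal (avg u z.1 ^ 2 * osc v z ^ 2)
      = ‖avg u z.1‖ₑ ^ 2 * (‖osc v z‖ₑ * ‖osc v z‖ₑ) := fun z => by
    rw [← sq, enorm_sq_eq, enorm_sq_eq, ENNReal.ofReal_mul (sq_nonneg _)]
  simp only [e1]
  refine h1.trans ?_
  have h2 : (∫⁻ x, ‖avg u x‖ₑ ^ 6) ^ (1 / 3 : ℝ) ≤ ENNReal.ofReal ((C + 1) * gradAvg u) := by
    have h3 : C * gradAvg u ^ 3 ≤ ((C + 1) * gradAvg u) ^ 3 := by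
      rw [mul_pow]
      refine mul_le_mul_of_nonneg_right ?_ (by positivity)
      nlinarith [sq_nonneg C, mul_nonneg hC (sq_nonneg C)]
    refine (ENNReal.rpow_le_rpow ((hS _ _ hu.wgrad_avg).trans (ENNReal.ofReal_le_ofReal h3))
      (by norm_num)).trans_eq ?_
    rw [ENNReal.ofReal_pow (by positivity), pow_rpow _ 3 1 (by norm_num), pow_one]
  refine (mul_le_mul' h2 (mul_le_mul' (rpow_half_le (by positivity) (hM v hv))
    (rpow_half_le (by positivity) hv.osc_poincare))).trans_eq ?_
  rw [← ENNReal.ofReal_mul (Real.sqrt_nonneg _), ← ENNReal.ofReal_mul (by positivity),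
    ← Real.sqrt_mul (by positivity)]
  congr 1
  have e2 : C₁ * gap v * (4 * π ^ 2 * ∫ z in Dom, grady v z ^ 2)
      = C₁ * (4 * π ^ 2) * (gap v * enY v) := by rw [enY]; ring
  rw [e2, Real.sqrt_mul (by positivity)]
  ring

lemma exists_quartic_const : ∃ C : ℝ, 0 ≤ C ∧ ∀ u, H1 u →
    Integrable (fun z : Pt => osc u z ^ 4) ((volume : Measure Pt3).prod circ) ∧
    ∫ z : Pt, osc u z ^ 4 ∂((volume : Measure Pt3).prod circ)
      ≤ C * gap u * Real.sqrt (gap u * enY u) := by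
  obtain ⟨C₁, hC₁, hM⟩ := exists_mixedSq_osc_const
  refine ⟨C₁ * Real.sqrt (C₁ * (8 * (π ^ 2 + 1))), by positivity, fun u hu => ?_⟩
  have hg := gap_nonneg u
  have hD := enY_nonneg u
  have ho := hu.measurable_osc
  refine integrable_and_integral_le_of_lintegral_le (by fun_prop) (fun z => by positivity)
    (by positivity) ?_
  simp only [← enorm_pow_four_eq]
  refine (lintegral_quartic_le (r := fun z => ‖osc u z‖ₑ) (k := fun z => ‖oscMajorant u z‖ₑ)
    ho.enorm hu.measurable_oscMajorant.enorm hu.ae_osc_sq_le).trans ?_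
  refine (mul_le_mul' (hM u hu) (mul_le_mul' (rpow_half_le (by positivity) (hM u hu))
    (rpow_half_le (by positivity) hu.lintegral_oscMajorant_sq_le))).trans_eq ?_
  rw [← ENNReal.ofReal_mul (Real.sqrt_nonneg _), ← ENNReal.ofReal_mul (by positivity),
    ← Real.sqrt_mul (by positivity)]
  congr 1
  rw [mul_right_comm C₁ (Real.sqrt _), mul_assoc _ (Real.sqrt _), ←
    Real.sqrt_mul (by positivity)]
  congr 2
  rw [enY]
  ring

lemma integral_osc (hu : Continuous u) (x : Pt3) : ∫ y, osc u (x, y) ∂circ = 0 := by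
  have hc : Continuous fun y => u (x, y) := hu.comp (Continuous.prodMk_right x)
  simp only [osc]
  rw [integral_sub hc.integrableOn_Ioc (integrable_const _), integral_eq_avg, integral_const,
    circ_real_univ, smul_eq_mul, sub_self]

lemma nonlin_eq (u v : Pt → ℝ) (z : Pt) : nonlin u v z = (u z ^ 2 + v z ^ 2) ^ 2 := by
  simp only [nonlin]; ring

lemma H1.integrable_nonlin (hu : H1 u) (hv : H1 v) : IntegrableOn (nonlin u v) Dom := by
  refine ((hu.memL4.add hv.memL4).const_mul 2).mono' ?_ (ae_of_all _ fun x => ?_)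
  · have h1 := hu.diff.continuous
    have h2 := hv.diff.continuous
    unfold nonlin
    exact Continuous.aestronglyMeasurable (by fun_prop)
  · rw [nonlin_eq, Real.norm_of_nonneg (sq_nonneg _)]
    simp only [Pi.add_apply]
    nlinarith [sq_nonneg (u x ^ 2 - v x ^ 2)]

lemma quartic_expand_le (P Q R S : ℝ) : ((P + R) ^ 2 + (Q + S) ^ 2) ^ 2 ≤
    ((P ^ 2 + Q ^ 2) ^ 2 + 4 * ((P ^ 2 + Q ^ 2) * (P * R + Q * S)))
      + (8 * (P ^ 2 * R ^ 2 + P ^ 2 * S ^ 2 + (Q ^ 2 * R ^ 2 + Q ^ 2 * S ^ 2))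
        + 6 * (R ^ 4 + S ^ 4)) := by
  have h1 : (P * R + Q * S) ^ 2 ≤ (P ^ 2 + Q ^ 2) * (R ^ 2 + S ^ 2) := by
    nlinarith [sq_nonneg (P * S - Q * R)]
  have h2 : 2 * (P * R + Q * S) * (R ^ 2 + S ^ 2)
      ≤ (P ^ 2 + Q ^ 2) * (R ^ 2 + S ^ 2) + (R ^ 2 + S ^ 2) ^ 2 := by
    have h3 : 2 * (P * R + Q * S) ≤ (P ^ 2 + Q ^ 2) + (R ^ 2 + S ^ 2) := by
      nlinarith [sq_nonneg (P - R), sq_nonneg (Q - S)]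
    have := mul_le_mul_of_nonneg_right h3 (by positivity : 0 ≤ R ^ 2 + S ^ 2)
    linarith
  have h4 : (R ^ 2 + S ^ 2) ^ 2 ≤ 2 * (R ^ 4 + S ^ 4) := by
    nlinarith [sq_nonneg (R ^ 2 - S ^ 2)]
  linarith

lemma abs_linear_term_le (P Q R S : ℝ) : |(P ^ 2 + Q ^ 2) * (P * R + Q * S)| ≤
    2 * (P ^ 2 + Q ^ 2) ^ 2 + (R ^ 4 + S ^ 4) := by
  have h4 : (R ^ 2 + S ^ 2) ^ 2 ≤ 2 * (R ^ 4 + S ^ 4) := by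
    nlinarith [sq_nonneg (R ^ 2 - S ^ 2)]
  have h0 : 0 ≤ P ^ 2 + Q ^ 2 := by positivity
  have h3 : |P * R + Q * S| ≤ (P ^ 2 + Q ^ 2) + (R ^ 2 + S ^ 2) := by
    rw [abs_le]
    constructor <;> nlinarith [sq_nonneg (P - R), sq_nonneg (Q - S), sq_nonneg (P + R),
      sq_nonneg (Q + S)]
  rw [abs_mul, abs_of_nonneg h0]
  have := mul_le_mul_of_nonneg_left h3 h0
  nlinarith [sq_nonneg (P ^ 2 + Q ^ 2 - (R ^ 2 + S ^ 2))]

/-- The nonlinearity is controlled by that of the averages, up to an error which is small when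
the pair is nearly independent of the circle variable. -/
theorem exists_interaction_const : ∃ C : ℝ, 0 ≤ C ∧ ∀ u v, H1 u → H1 v →
    ∫ z in Dom, nonlin u v z ≤ 2 * π * (∫ x, nonlin3 (avg u) (avg v) x)
      + C * (gradAvg u + gradAvg v + (gap u + gap v))
        * Real.sqrt ((gap u + gap v) * (enY u + enY v)) := by
  obtain ⟨C₁, hC₁, hX⟩ := exists_cross_const
  obtain ⟨C₂, hC₂, hQ⟩ := exists_quartic_const
  refine ⟨8 * (2 * C₁) + 6 * C₂, by positivity, fun u v hu hv => ?_⟩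
  obtain ⟨i1, b1⟩ := hX u u hu hu
  obtain ⟨i2, b2⟩ := hX u v hu hv
  obtain ⟨i3, b3⟩ := hX v u hv hu
  obtain ⟨i4, b4⟩ := hX v v hv hv
  obtain ⟨i5, b5⟩ := hQ u hu
  obtain ⟨i6, b6⟩ := hQ v hv
  have i0 : Integrable (fun z : Pt => (avg u z.1 ^ 2 + avg v z.1 ^ 2) ^ 2)
      ((volume : Measure Pt3).prod circ) := by
    have := (hu.wgrad_avg.integrable_nonlin3 hv.wgrad_avg).comp_fst circ
    simpa only [nonlin3_eq] using this
  have hmu : Measurable fun z : Pt => avg u z.1 := (measurable_avg hu.measurable).comp measurable_fst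
  have hmv : Measurable fun z : Pt => avg v z.1 := (measurable_avg hv.measurable).comp measurable_fst
  have hou := hu.measurable_osc
  have hov := hv.measurable_osc
  have iL : Integrable (fun z : Pt => (avg u z.1 ^ 2 + avg v z.1 ^ 2)
      * (avg u z.1 * osc u z + avg v z.1 * osc v z)) ((volume : Measure Pt3).prod circ) :=
    ((i0.const_mul 2).add (i5.add i6)).mono' (((hmu.pow_const 2).add (hmv.pow_const 2)).mul
      ((hmu.mul hou).add (hmv.mul hov))).aestronglyMeasurable
      (ae_of_all _ fun z => abs_linear_term_le _ _ _ _)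
  have eL : ∫ z : Pt, (avg u z.1 ^ 2 + avg v z.1 ^ 2)
      * (avg u z.1 * osc u z + avg v z.1 * osc v z) ∂((volume : Measure Pt3).prod circ) = 0 := by
    rw [integral_prod _ iL]
    refine integral_eq_zero_of_ae (ae_of_all _ fun x => ?_)
    have c1 : Integrable (fun y => osc u (x, y)) circ := by
      have h : Continuous fun y => u (x, y) - avg u x :=
        (hu.diff.continuous.comp (Continuous.prodMk_right x)).sub continuous_const
      exact h.integrableOn_Ioc
    have c2 : Integrable (fun y => osc v (x, y)) circ := by
      have h : Continuous fun y => v (x, y) - avg v x :=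
        (hv.diff.continuous.comp (Continuous.prodMk_right x)).sub continuous_const
      exact h.integrableOn_Ioc
    dsimp only [Pi.zero_apply]
    rw [integral_const_mul, integral_add (c1.const_mul _) (c2.const_mul _), integral_const_mul,
      integral_const_mul, integral_osc hu.diff.continuous, integral_osc hv.diff.continuous]
    simp
  have iX := ((i1.add i2).add (i3.add i4)).const_mul 8
  have iQ := (i5.add i6).const_mul 6
  have hmono : ∫ z in Dom, nonlin u v z ≤ ∫ z : Pt,
      (((avg u z.1 ^ 2 + avg v z.1 ^ 2) ^ 2 + 4 * ((avg u z.1 ^ 2 + avg v z.1 ^ 2)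
        * (avg u z.1 * osc u z + avg v z.1 * osc v z)))
      + (8 * (avg u z.1 ^ 2 * osc u z ^ 2 + avg u z.1 ^ 2 * osc v z ^ 2
        + (avg v z.1 ^ 2 * osc u z ^ 2 + avg v z.1 ^ 2 * osc v z ^ 2))
        + 6 * (osc u z ^ 4 + osc v z ^ 4))) ∂((volume : Measure Pt3).prod circ) := by
    rw [restrict_dom]
    refine integral_mono (restrict_dom ▸ hu.integrable_nonlin hv)
      ((i0.add (iL.const_mul 4)).add (iX.add iQ)) fun z => ?_
    have := quartic_expand_le (avg u z.1) (avg v z.1) (osc u z) (osc v z)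
    have e : ∀ w : Pt → ℝ, avg w z.1 + osc w z = w z := fun w => by simp only [osc]; ring
    rw [e, e] at this
    rw [nonlin_eq]
    exact this
  refine hmono.trans ?_
  have iX' : Integrable (fun z : Pt => 8 * (avg u z.1 ^ 2 * osc u z ^ 2
      + avg u z.1 ^ 2 * osc v z ^ 2 + (avg v z.1 ^ 2 * osc u z ^ 2
      + avg v z.1 ^ 2 * osc v z ^ 2))) ((volume : Measure Pt3).prod circ) := iX
  have iQ' : Integrable (fun z : Pt => 6 * (osc u z ^ 4 + osc v z ^ 4))
      ((volume : Measure Pt3).prod circ) := iQ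
  have iX₁ : Integrable (fun z : Pt => avg u z.1 ^ 2 * osc u z ^ 2 + avg u z.1 ^ 2 * osc v z ^ 2)
      ((volume : Measure Pt3).prod circ) := i1.add i2
  have iX₂ : Integrable (fun z : Pt => avg v z.1 ^ 2 * osc u z ^ 2 + avg v z.1 ^ 2 * osc v z ^ 2)
      ((volume : Measure Pt3).prod circ) := i3.add i4
  rw [integral_add (f := fun z : Pt => (avg u z.1 ^ 2 + avg v z.1 ^ 2) ^ 2
      + 4 * ((avg u z.1 ^ 2 + avg v z.1 ^ 2) * (avg u z.1 * osc u z + avg v z.1 * osc v z)))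
      (g := fun z : Pt => 8 * (avg u z.1 ^ 2 * osc u z ^ 2 + avg u z.1 ^ 2 * osc v z ^ 2
      + (avg v z.1 ^ 2 * osc u z ^ 2 + avg v z.1 ^ 2 * osc v z ^ 2))
      + 6 * (osc u z ^ 4 + osc v z ^ 4))
      (i0.add (iL.const_mul 4)) (iX'.add iQ'), integral_add i0 (iL.const_mul 4),
    integral_add iX' iQ', integral_const_mul, integral_const_mul, integral_const_mul, eL,
    integral_add iX₁ iX₂, integral_add i1 i2, integral_add i3 i4, integral_add i5 i6]
  rw [integral_comp_fst fun x => (avg u x ^ 2 + avg v x ^ 2) ^ 2]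
  simp only [← nonlin3_eq]
  have g1 := gap_nonneg u
  have g2 := gap_nonneg v
  have d1 := enY_nonneg u
  have d2 := enY_nonneg v
  have x1 := gradAvg_nonneg u
  have x2 := gradAvg_nonneg v
  have s1 : Real.sqrt (gap u * enY u) ≤ Real.sqrt ((gap u + gap v) * (enY u + enY v)) :=
    Real.sqrt_le_sqrt (by gcongr <;> linarith)
  have s2 : Real.sqrt (gap v * enY v) ≤ Real.sqrt ((gap u + gap v) * (enY u + enY v)) :=
    Real.sqrt_le_sqrt (by gcongr <;> linarith)
  set s := Real.sqrt ((gap u + gap v) * (enY u + enY v))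
  have hs : 0 ≤ s := Real.sqrt_nonneg _
  have b1' := b1.trans (mul_le_mul_of_nonneg_left s1 (by positivity))
  have b2' := b2.trans (mul_le_mul_of_nonneg_left s2 (by positivity))
  have b3' := b3.trans (mul_le_mul_of_nonneg_left s1 (by positivity))
  have b4' := b4.trans (mul_le_mul_of_nonneg_left s2 (by positivity))
  have b5' := b5.trans (mul_le_mul_of_nonneg_left s1 (by positivity))
  have b6' := b6.trans (mul_le_mul_of_nonneg_left s2 (by positivity))
  have p1 : 0 ≤ C₁ * (gap u + gap v) * s := by positivity
  have p2 : 0 ≤ C₂ * (gradAvg u + gradAvg v) * s := by positivity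
  linarith

end Interaction

section Rigidity

variable {u v : Pt → ℝ}

/-- The `x`-part of the kinetic energy of a pair. -/
def enX (u v : Pt → ℝ) : ℝ := ∫ z in Dom, (gradSqX u z + gradSqX v z)

lemma H1.enX_eq (hu : H1 u) (hv : H1 v) :
    enX u v = 2 * π * (gradAvg u + gradAvg v) + (gap u + gap v) := by
  rw [enX, integral_add hu.integrable_gradSqX hv.integrable_gradSqX, hu.gap_eq, hv.gap_eq]
  ring

lemma H1.integral_avg_sq_le (hu : H1 u) :
    2 * π * ∫ x, avg u x ^ 2 ≤ ∫ z in Dom, u z ^ 2 := by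
  have h := integral_sub_avg_sq hu.measurable hu.memLp
  have h0 : 0 ≤ ∫ z : Pt, (u z - avg u z.1) ^ 2 ∂((volume : Measure Pt3).prod circ) :=
    integral_nonneg fun _ => sq_nonneg _
  rw [restrict_dom]
  linarith

lemma H1.integral_nonlin_pos (hu : H1 u) (hv : H1 v) (hpos : 0 < ∫ z in Dom, u z ^ 2) :
    0 < ∫ z in Dom, nonlin u v z := by
  have h0 : ∀ z, 0 ≤ nonlin u v z := fun z => by rw [nonlin_eq]; positivity
  refine (integral_nonneg h0).lt_of_ne fun h => ?_
  have h1 := (integral_eq_zero_iff_of_nonneg h0 (hu.integrable_nonlin hv)).1 h.symm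
  refine hpos.ne' (integral_eq_zero_of_ae ?_)
  filter_upwards [h1] with z hz
  rw [nonlin_eq, Pi.zero_apply, sq_eq_zero_iff] at hz
  simp only [Pi.zero_apply]
  nlinarith [sq_nonneg (u z), sq_nonneg (v z)]

lemma threshold_of_interaction {T C A a D : ℝ} (hT : 0 < T) (hA : 0 < A)
    (ha : 0 ≤ a) (haA : a ≤ A) (hD : 0 ≤ D)
    (h : 4 / 3 * A ≤ Real.sqrt (8 / (27 * T) * (A - a) ^ 3) + C * A * Real.sqrt (a * D)) :
    6 * T ≤ A + 81 / 8 * T ^ 2 * C ^ 2 * D := by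
  obtain ⟨t, ht, htT⟩ : ∃ t : ℝ, 0 < t ∧ t ^ 2 = 6 * T :=
    ⟨Real.sqrt (6 * T), by positivity, Real.sq_sqrt (by positivity)⟩
  obtain ⟨x, hx, rfl⟩ : ∃ x : ℝ, 0 < x ∧ x ^ 2 = A :=
    ⟨Real.sqrt A, by positivity, Real.sq_sqrt hA.le⟩
  obtain ⟨b, rfl⟩ : ∃ b, a = b * x ^ 2 := ⟨a / x ^ 2, by field_simp⟩
  have hb : 0 ≤ b := nonneg_of_mul_nonneg_left ha hA
  have hb1 : 0 ≤ 1 - b := by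
    by_contra hcon
    push Not at hcon
    nlinarith
  rcases le_or_gt t x with htx | hxt
  · have : t ^ 2 ≤ x ^ 2 := pow_le_pow_left₀ ht.le htx 2
    have : 0 ≤ 81 / 8 * T ^ 2 * C ^ 2 * D := by positivity
    linarith
  set s := Real.sqrt (b * D) with hs
  have hs2 : s ^ 2 = b * D := Real.sq_sqrt (by positivity)
  have e1 : Real.sqrt (b * x ^ 2 * D) = x * s := by
    rw [hs, show b * x ^ 2 * D = x ^ 2 * (b * D) by ring, Real.sqrt_mul (by positivity),
      Real.sqrt_sq hx.le]
  have e2 : Real.sqrt (8 / (27 * T) * (x ^ 2 - b * x ^ 2) ^ 3)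
      ≤ 4 / (3 * t) * x * (x ^ 2 - b * x ^ 2) := by
    have h1 : 0 ≤ x ^ 2 - b * x ^ 2 := by nlinarith
    refine Real.sqrt_le_iff.2 ⟨by positivity, ?_⟩
    have e3 : 8 / (27 * T) = (4 / (3 * t)) ^ 2 := by
      rw [div_pow, mul_pow, htT]; field_simp; norm_num
    rw [e3, mul_pow, mul_pow, mul_assoc]
    refine mul_le_mul_of_nonneg_left ?_ (sq_nonneg _)
    rw [pow_succ']
    refine mul_le_mul_of_nonneg_right ?_ (sq_nonneg _)
    nlinarith
  rw [e1] at h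
  have h2 : 4 / 3 ≤ 4 / (3 * t) * x * (1 - b) + C * x * s := by
    have h3 := h.trans (add_le_add_left e2 _)
    have h4 : 4 / 3 * x ^ 2 ≤ (4 / (3 * t) * x * (1 - b) + C * x * s) * x ^ 2 := by
      refine h3.trans_eq ?_; ring
    exact le_of_mul_le_mul_right h4 hA
  have h5 : C * s ≤ 4 / (3 * t) * b + 3 * t / 16 * C ^ 2 * D := by
    refine le_of_sq_le_sq ?_ (by positivity)
    have e4 : (C * s) ^ 2 = 4 * (4 / (3 * t) * b) * (3 * t / 16 * C ^ 2 * D) := by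
      rw [mul_pow, hs2]; field_simp; norm_num
    rw [e4]
    nlinarith [sq_nonneg (4 / (3 * t) * b - 3 * t / 16 * C ^ 2 * D)]
  have h6 : 4 / 3 ≤ 4 / (3 * t) * x + 3 * t / 16 * C ^ 2 * D * x := by
    nlinarith [mul_le_mul_of_nonneg_left h5 hx.le]
  have h7 : t - x ≤ 9 * t ^ 2 / 64 * C ^ 2 * D * x := by
    have h8 := mul_le_mul_of_nonneg_left h6 (by positivity : 0 ≤ 3 * t / 4)
    have e5 : 3 * t / 4 * (4 / (3 * t) * x + 3 * t / 16 * C ^ 2 * D * x)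
        = x + 9 * t ^ 2 / 64 * C ^ 2 * D * x := by field_simp; ring
    linarith
  have h9 : 9 * t ^ 2 / 64 * C ^ 2 * D * x ≤ 9 * t ^ 2 / 64 * C ^ 2 * D * t :=
    mul_le_mul_of_nonneg_left hxt.le (by positivity)
  have h10 : (t - x) * (t + x) ≤ (9 * t ^ 2 / 64 * C ^ 2 * D * t) * (2 * t) :=
    mul_le_mul (h7.trans h9) (by linarith) (by positivity) (by positivity)
  have e6 : (9 * t ^ 2 / 64 * C ^ 2 * D * t) * (2 * t) = 81 / 8 * T ^ 2 * C ^ 2 * D := by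
    have : t ^ 4 = 36 * T ^ 2 := by rw [show t ^ 4 = (t ^ 2) ^ 2 by ring, htT]; ring
    linear_combination (9 / 32 * C ^ 2 * D) * this
  nlinarith

/-- Pairs of unit mass on the constraint whose kinetic energy is below the level of the planar
ground states carry a proportional amount of `y`-energy. -/
theorem exists_threshold_const : ∃ C : ℝ, 0 ≤ C ∧ ∀ u v, H1 u → H1 v →
    ∫ z in Dom, u z ^ 2 = 1 → ∫ z in Dom, v z ^ 2 = 1 → svirial u v = 0 →
    6 * (4 * π ^ 2 * mhat 1) ≤ enX u v + C * (enY u + enY v) := by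
  obtain ⟨C, hC, hI⟩ := exists_interaction_const
  have hm := mhat_one_pos
  refine ⟨81 / 8 * (4 * π ^ 2 * mhat 1) ^ 2 * C ^ 2, by positivity, fun u v hu hv mu mv hQ => ?_⟩
  have hB := hu.integral_nonlin_pos hv (by rw [mu]; norm_num)
  have hQ' : enX u v - 3 / 4 * ∫ z in Dom, nonlin u v z = 0 := hQ
  have hg := add_nonneg (gap_nonneg u) (gap_nonneg v)
  have hX := add_nonneg (gradAvg_nonneg u) (gradAvg_nonneg v)
  have hE := hu.enX_eq hv
  have hGN := hu.wgrad_avg.sharp_gagliardo_nirenberg hv.wgrad_avg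
  change _ ≤ Real.sqrt (8 / (27 * mhat 1) * (gradAvg u + gradAvg v) ^ 3 * _) at hGN
  have hπ := Real.pi_pos
  refine threshold_of_interaction (a := gap u + gap v) (by positivity) (by linarith) hg
    (by nlinarith) (add_nonneg (enY_nonneg u) (enY_nonneg v)) ?_
  have h1 := hI u v hu hv
  have hmass : ((∫ x, avg u x ^ 2) + ∫ x, avg v x ^ 2) / 2 ≤ 1 / (2 * π) := by
    have a1 := hu.integral_avg_sq_le
    have a2 := hv.integral_avg_sq_le
    rw [mu] at a1
    rw [mv] at a2
    rw [le_div_iff₀ (by positivity)]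
    linarith
  have h2 : 2 * π * ∫ x, nonlin3 (avg u) (avg v) x
      ≤ Real.sqrt (8 / (27 * (4 * π ^ 2 * mhat 1)) * (enX u v - (gap u + gap v)) ^ 3) := by
    have e : 8 / (27 * (4 * π ^ 2 * mhat 1)) * (enX u v - (gap u + gap v)) ^ 3
        = (2 * π) ^ 2 * (8 / (27 * mhat 1) * (gradAvg u + gradAvg v) ^ 3 * (1 / (2 * π))) := by
      rw [hE]; field_simp; ring
    rw [e, Real.sqrt_mul (by positivity), Real.sqrt_sq (by positivity)]
    refine mul_le_mul_of_nonneg_left (hGN.trans (Real.sqrt_le_sqrt ?_)) (by positivity)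
    exact mul_le_mul_of_nonneg_left hmass (by positivity)
  have h3 : C * (gradAvg u + gradAvg v + (gap u + gap v)) ≤ C * enX u v := by
    refine mul_le_mul_of_nonneg_left ?_ hC
    nlinarith [Real.pi_gt_three]
  have h4 := mul_le_mul_of_nonneg_right h3
    (Real.sqrt_nonneg ((gap u + gap v) * (enY u + enY v)))
  linarith

end Rigidity

section Scaling

variable {u v : Pt → ℝ} {β : ℝ}

/-- The horizontal dilation `(x, y) ↦ (β x, y)`. -/
def dilX (β : ℝ) (z : Pt) : Pt := (β • z.1, z.2)

lemma measurableEmbedding_dilX (hβ : 0 < β) : MeasurableEmbedding (dilX β) :=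
  ((Homeomorph.smulOfNeZero β hβ.ne').prodCongr (Homeomorph.refl ℝ)).measurableEmbedding

lemma map_dilX (hβ : 0 < β) : ((volume : Measure Pt).restrict Dom).map (dilX β)
    = ENNReal.ofReal (β ^ 3)⁻¹ • (volume : Measure Pt).restrict Dom := by
  have h := Measure.map_prod_map (volume : Measure Pt3) circ (measurable_const_smul β)
    measurable_id
  rw [Measure.map_id, Measure.map_addHaar_smul _ hβ.ne', Measure.prod_smul_left] at h
  rw [restrict_dom]
  have e : (dilX β : Pt → Pt) = Prod.map (fun x => β • x) id := rfl
  rw [e, ← h, abs_of_nonneg (by positivity)]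
  simp

lemma setIntegral_comp_dilX (F : Pt → ℝ) (hβ : 0 < β) :
    ∫ z in Dom, F (dilX β z) = (β ^ 3)⁻¹ * ∫ z in Dom, F z := by
  rw [← (measurableEmbedding_dilX hβ).integral_map, map_dilX hβ, integral_smul_measure,
    ENNReal.toReal_ofReal (by positivity), smul_eq_mul]

lemma integrableOn_comp_dilX {F : Pt → ℝ} (hF : IntegrableOn F Dom) (hβ : 0 < β) :
    IntegrableOn (fun z => F (dilX β z)) Dom := by
  have h : Integrable F (((volume : Measure Pt).restrict Dom).map (dilX β)) := by
    rw [map_dilX hβ]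
    exact hF.smul_measure ENNReal.ofReal_ne_top
  exact (measurableEmbedding_dilX hβ).integrable_map_iff.1 h

/-- The rescaled function `(x, y) ↦ α u(β x, y)`. -/
def resc (α β : ℝ) (u : Pt → ℝ) (z : Pt) : ℝ := α * u (dilX β z)

lemma hasFDerivAt_resc (hu : Differentiable ℝ u) (α β : ℝ) (z : Pt) :
    HasFDerivAt (resc α β u) (α • (fderiv ℝ u (dilX β z)).comp
      ((β • ContinuousLinearMap.id ℝ Pt3).prodMap (ContinuousLinearMap.id ℝ ℝ))) z :=
  ((hu (dilX β z)).hasFDerivAt.comp z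
    ((β • ContinuousLinearMap.id ℝ Pt3).prodMap
      (ContinuousLinearMap.id ℝ ℝ)).hasFDerivAt).const_mul α

lemma gradSqX_resc (hu : Differentiable ℝ u) (α β : ℝ) (z : Pt) :
    gradSqX (resc α β u) z = α ^ 2 * β ^ 2 * gradSqX u (dilX β z) := by
  have e : ∀ i, gradx (resc α β u) z i = α * β * gradx u (dilX β z) i := fun i => by
    have h : ((β • ContinuousLinearMap.id ℝ Pt3).prodMap (ContinuousLinearMap.id ℝ ℝ)) (ex i)
        = β • ex i := by
      ext <;> simp [ex]
    rw [gradx, (hasFDerivAt_resc hu α β z).fderiv, smul_apply, ContinuousLinearMap.comp_apply, h,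
      map_smul, smul_eq_mul, smul_eq_mul, gradx, mul_assoc]
  simp only [gradSqX, e, mul_pow, Finset.mul_sum]

lemma grady_resc (hu : Differentiable ℝ u) (α β : ℝ) (z : Pt) :
    grady (resc α β u) z = α * grady u (dilX β z) := by
  have h : ((β • ContinuousLinearMap.id ℝ Pt3).prodMap (ContinuousLinearMap.id ℝ ℝ)) ey = ey := by
    ext <;> simp [ey]
  rw [grady, (hasFDerivAt_resc hu α β z).fderiv, smul_apply, ContinuousLinearMap.comp_apply, h,
    smul_eq_mul, grady]

lemma H1.resc (hu : H1 u) (α : ℝ) (hβ : 0 < β) : H1 (resc α β u) where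
  periodic x y := by
    simp only [Waveguide.resc, dilX]
    rw [hu.periodic]
  diff z := (hasFDerivAt_resc hu.diff α β z).differentiableAt
  memL2 := by
    simp only [Waveguide.resc, mul_pow]
    exact (integrableOn_comp_dilX hu.memL2 hβ).const_mul _
  memGrad := by
    simp only [gradSq, gradSqX_resc hu.diff, grady_resc hu.diff, mul_pow]
    exact ((integrableOn_comp_dilX hu.integrable_gradSqX hβ).const_mul _).add
      ((integrableOn_comp_dilX hu.integrable_grady_sq hβ).const_mul _)
  memL4 := by
    simp only [Waveguide.resc, mul_pow]
    exact (integrableOn_comp_dilX hu.memL4 hβ).const_mul _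

lemma integral_sq_resc (u : Pt → ℝ) (α : ℝ) (hβ : 0 < β) :
    ∫ z in Dom, resc α β u z ^ 2 = α ^ 2 * (β ^ 3)⁻¹ * ∫ z in Dom, u z ^ 2 := by
  simp only [resc, mul_pow]
  rw [integral_const_mul, setIntegral_comp_dilX (fun z => u z ^ 2) hβ, mul_assoc]

lemma enX_resc (hu : Differentiable ℝ u) (hv : Differentiable ℝ v) (α : ℝ) (hβ : 0 < β) :
    enX (resc α β u) (resc α β v) = α ^ 2 * β⁻¹ * enX u v := by
  simp only [enX, gradSqX_resc hu, gradSqX_resc hv, ← mul_add]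
  rw [integral_const_mul, setIntegral_comp_dilX (fun z => gradSqX u z + gradSqX v z) hβ]
  field_simp

lemma enY_resc (hu : Differentiable ℝ u) (α : ℝ) (hβ : 0 < β) :
    enY (resc α β u) = α ^ 2 * (β ^ 3)⁻¹ * enY u := by
  simp only [enY, grady_resc hu, mul_pow]
  rw [integral_const_mul, setIntegral_comp_dilX (fun z => grady u z ^ 2) hβ, mul_assoc]

lemma integral_nonlin_resc (u v : Pt → ℝ) (α : ℝ) (hβ : 0 < β) :
    ∫ z in Dom, nonlin (resc α β u) (resc α β v) z
      = α ^ 4 * (β ^ 3)⁻¹ * ∫ z in Dom, nonlin u v z := by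
  have e : ∀ z, nonlin (resc α β u) (resc α β v) z = α ^ 4 * nonlin u v (dilX β z) := fun z => by
    simp only [nonlin, resc]; ring
  simp only [e]
  rw [integral_const_mul, setIntegral_comp_dilX (nonlin u v) hβ, mul_assoc]

lemma svirial_eq (u v : Pt → ℝ) : svirial u v = enX u v - 3 / 4 * ∫ z in Dom, nonlin u v z := rfl

lemma energy_eq (hu : H1 u) (hv : H1 v) (hQ : svirial u v = 0) :
    energy u v = enX u v / 6 + (enY u + enY v) / 2 := by
  have h : ∫ z in Dom, (gradSq u z + gradSq v z) = enX u v + (enY u + enY v) := by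
    have i1 : IntegrableOn (fun z => gradSqX u z + gradSqX v z) Dom :=
      hu.integrable_gradSqX.add hv.integrable_gradSqX
    have i2 : IntegrableOn (fun z => grady u z ^ 2 + grady v z ^ 2) Dom :=
      hu.integrable_grady_sq.add hv.integrable_grady_sq
    rw [enX, enY, enY, ← integral_add hu.integrable_grady_sq hv.integrable_grady_sq,
      ← integral_add i1 i2]
    congr 1 with z
    simp only [gradSq]
    ring
  rw [svirial_eq] at hQ
  rw [energy, h]
  linarith

lemma enX_nonneg (u v : Pt → ℝ) : 0 ≤ enX u v :=
  integral_nonneg fun z => add_nonneg (gradSqX_nonneg u z) (gradSqX_nonneg v z)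

lemma inS_iff {Θ : ℝ} (hΘ : 0 < Θ) : inS Θ u ↔ H1 u ∧ ∫ z in Dom, u z ^ 2 = Θ ^ 2 := by
  rw [inS, l2, Real.sqrt_eq_iff_eq_sq (integral_nonneg fun _ => sq_nonneg _) hΘ.le]

lemma mlevel_le {Θ : ℝ} (hu : inS Θ u) (hv : inS Θ v) (hQ : svirial u v = 0) :
    mlevel Θ ≤ energy u v := by
  refine csInf_le ⟨0, ?_⟩ ⟨u, v, hu, hv, hQ, rfl⟩
  rintro c ⟨u, v, hu, hv, hQ, rfl⟩
  rw [energy_eq hu.1 hv.1 hQ]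
  have := enX_nonneg u v
  have := enY_nonneg u
  have := enY_nonneg v
  positivity

/-- Dilating a pair of mass `Θ'` onto the constraint set of mass `Θ`. -/
lemma exists_dilated_pair {Θ Θ' : ℝ} (hΘ : 0 < Θ) (hΘ' : 0 < Θ') (hu : inS Θ' u) (hv : inS Θ' v)
    (hQ : svirial u v = 0) : ∃ p q : Pt → ℝ, inS Θ p ∧ inS Θ q ∧ svirial p q = 0 ∧
      enX p q = Θ' ^ 2 / Θ ^ 2 * enX u v ∧ enY p = Θ ^ 2 / Θ' ^ 2 * enY u ∧
      enY q = Θ ^ 2 / Θ' ^ 2 * enY v := by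
  rw [inS_iff hΘ'] at hu hv
  have hl : 0 < Θ' ^ 2 / Θ ^ 2 := by positivity
  refine ⟨resc (Θ' ^ 2 / Θ ^ 2) (Θ' ^ 2 / Θ ^ 2) u, resc (Θ' ^ 2 / Θ ^ 2) (Θ' ^ 2 / Θ ^ 2) v,
    (inS_iff hΘ).2 ⟨hu.1.resc _ hl, ?_⟩, (inS_iff hΘ).2 ⟨hv.1.resc _ hl, ?_⟩, ?_, ?_, ?_, ?_⟩
  · rw [integral_sq_resc u _ hl, hu.2]; field_simp
  · rw [integral_sq_resc v _ hl, hv.2]; field_simp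
  · rw [svirial_eq] at hQ
    rw [svirial_eq, enX_resc hu.1.diff hv.1.diff _ hl, integral_nonlin_resc u v _ hl]
    have e : (Θ' ^ 2 / Θ ^ 2) ^ 2 * (Θ' ^ 2 / Θ ^ 2)⁻¹ = Θ' ^ 2 / Θ ^ 2 := by field_simp
    have e' : (Θ' ^ 2 / Θ ^ 2) ^ 4 * ((Θ' ^ 2 / Θ ^ 2) ^ 3)⁻¹ = Θ' ^ 2 / Θ ^ 2 := by field_simp
    rw [e, e']
    linear_combination (Θ' ^ 2 / Θ ^ 2) * hQ
  · rw [enX_resc hu.1.diff hv.1.diff _ hl]; field_simp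
  · rw [enY_resc hu.1.diff _ hl]; field_simp
  · rw [enY_resc hv.1.diff _ hl]; field_simp

lemma mlevel_le_dilated {Θ Θ' : ℝ} (hΘ : 0 < Θ) (hΘ' : 0 < Θ') (hu : inS Θ' u) (hv : inS Θ' v)
    (hQ : svirial u v = 0) :
    Θ ^ 2 * mlevel Θ ≤ Θ' ^ 2 * (enX u v / 6) + Θ ^ 4 / Θ' ^ 2 * ((enY u + enY v) / 2) := by
  obtain ⟨p, q, hp, hq, hpq, h1, h2, h3⟩ := exists_dilated_pair hΘ hΘ' hu hv hQ
  have h := mul_le_mul_of_nonneg_left (mlevel_le hp hq hpq) (sq_nonneg Θ)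
  rw [energy_eq hp.1 hq.1 hpq, h1, h2, h3] at h
  refine h.trans_eq ?_
  field_simp

end Scaling

section Separable

variable {h : ℝ → ℝ} {P R : Pt3 → ℝ}

/-- The function `(x, y) ↦ h(y) P(x)`. -/
def sepFun (h : ℝ → ℝ) (P : Pt3 → ℝ) (z : Pt) : ℝ := P z.1 * h z.2

lemma hasFDerivAt_sepFun (hh : Differentiable ℝ h) (hP : Differentiable ℝ P) (z : Pt) :
    HasFDerivAt (sepFun h P) (P z.1 • (deriv h z.2 • ContinuousLinearMap.snd ℝ Pt3 ℝ)
      + h z.2 • (fderiv ℝ P z.1).comp (ContinuousLinearMap.fst ℝ Pt3 ℝ)) z :=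
  ((hP z.1).hasFDerivAt.comp z hasFDerivAt_fst).mul
    ((hh z.2).hasDerivAt.comp_hasFDerivAt z hasFDerivAt_snd)

lemma grady_sepFun (hh : Differentiable ℝ h) (hP : Differentiable ℝ P) (z : Pt) :
    grady (sepFun h P) z = P z.1 * deriv h z.2 := by
  rw [grady, (hasFDerivAt_sepFun hh hP z).fderiv]
  simp [ey]

lemma gradSqX_sepFun (hh : Differentiable ℝ h) (hP : Differentiable ℝ P) (z : Pt) :
    gradSqX (sepFun h P) z = gradSq3 P z.1 * h z.2 ^ 2 := by
  have e : ∀ i, gradx (sepFun h P) z i = grad3 P z.1 i * h z.2 := fun i => by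
    rw [gradx, (hasFDerivAt_sepFun hh hP z).fderiv]
    simp only [ex, add_apply, smul_apply, ContinuousLinearMap.coe_snd', smul_eq_mul, mul_zero,
      ContinuousLinearMap.comp_apply, ContinuousLinearMap.coe_fst', zero_add, grad3, mul_comm]
    rfl
  simp only [gradSqX, e, gradSq3, Finset.sum_mul, mul_pow]

lemma setIntegral_mul_sep (f : Pt3 → ℝ) (g : ℝ → ℝ) :
    ∫ z in Dom, f z.1 * g z.2 = (∫ x, f x) * ∫ y, g y ∂circ := by
  rw [restrict_dom, integral_prod_mul]

lemma integrableOn_mul_sep {f : Pt3 → ℝ} {g : ℝ → ℝ} (hf : Integrable f) (hg : Continuous g) :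
    IntegrableOn (fun z : Pt => f z.1 * g z.2) Dom := by
  rw [IntegrableOn, restrict_dom]
  exact hf.mul_prod hg.integrableOn_Ioc

lemma h1_sepFun (hh : Differentiable ℝ h) (hh' : Continuous (deriv h))
    (hper : ∀ y, h (y + 2 * π) = h y) (hP : H1R3 P) : H1 (sepFun h P) where
  periodic x y := by simp only [sepFun, hper]
  diff z := (hasFDerivAt_sepFun hh hP.diff z).differentiableAt
  memL2 := by
    simp only [sepFun, mul_pow]
    exact integrableOn_mul_sep hP.memL2 (hh.continuous.pow 2)
  memGrad := by
    simp only [gradSq, gradSqX_sepFun hh hP.diff, grady_sepFun hh hP.diff, mul_pow]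
    exact (integrableOn_mul_sep hP.memGrad (hh.continuous.pow 2)).add
      (integrableOn_mul_sep hP.memL2 (hh'.pow 2))
  memL4 := by
    simp only [sepFun, mul_pow]
    exact integrableOn_mul_sep hP.memL4 (hh.continuous.pow 4)

/-- Separable trial pairs. -/
lemma exists_separable_pair (hh : Differentiable ℝ h) (hh' : Continuous (deriv h))
    (hper : ∀ y, h (y + 2 * π) = h y) (h2 : ∫ y, h y ^ 2 ∂circ = 1) {κ : ℝ} (hκ : 0 < κ)
    (h4 : ∫ y, h y ^ 4 ∂circ = κ) (hP : H1R3 P) (hR : H1R3 R) (hP1 : l2R3 P = 1)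
    (hR1 : l2R3 R = 1) (hQ : Qhat P R = 0) {Θ : ℝ} (hΘ : 0 < Θ) :
    ∃ u v : Pt → ℝ, inS Θ u ∧ inS Θ v ∧ svirial u v = 0 ∧
      energy u v = Ihat P R / (κ ^ 2 * Θ ^ 2) + Θ ^ 2 * ∫ y, deriv h y ^ 2 ∂circ := by
  rw [l2R3_eq_iff one_pos, one_pow] at hP1 hR1
  have hu := h1_sepFun hh hh' hper hP
  have hv := h1_sepFun hh hh' hper hR
  have hβ : 0 < 1 / (κ * Θ ^ 2) := by positivity
  obtain ⟨α, hα⟩ : ∃ α : ℝ, α ^ 2 = (1 / (κ * Θ ^ 2)) ^ 2 / κ :=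
    ⟨Real.sqrt _, Real.sq_sqrt (by positivity)⟩
  have mass : ∀ F : Pt3 → ℝ, ∫ x, F x ^ 2 = 1 → ∫ z in Dom, sepFun h F z ^ 2 = 1 := fun F hF => by
    simp only [sepFun, mul_pow]
    rw [setIntegral_mul_sep (fun x => F x ^ 2) (fun y => h y ^ 2), hF, h2, one_mul]
  have ey : ∀ F : Pt3 → ℝ, Differentiable ℝ F → ∫ x, F x ^ 2 = 1 →
      enY (sepFun h F) = ∫ y, deriv h y ^ 2 ∂circ := fun F hd hF => by
    simp only [enY, grady_sepFun hh hd, mul_pow]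
    rw [setIntegral_mul_sep (fun x => F x ^ 2) (fun y => deriv h y ^ 2), hF, one_mul]
  have ex : enX (sepFun h P) (sepFun h R) = 6 * Ihat P R := by
    simp only [enX, gradSqX_sepFun hh hP.diff, gradSqX_sepFun hh hR.diff, ← add_mul]
    rw [setIntegral_mul_sep (fun x => gradSq3 P x + gradSq3 R x) (fun y => h y ^ 2), h2,
      Ihat_eq_of_Qhat hQ]
    ring
  have en : ∫ z in Dom, nonlin (sepFun h P) (sepFun h R) z = κ * (8 * Ihat P R) := by
    have e : ∀ z : Pt, nonlin (sepFun h P) (sepFun h R) z = nonlin3 P R z.1 * h z.2 ^ 4 :=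
      fun z => by simp only [nonlin, nonlin3, sepFun]; ring
    simp only [e]
    rw [setIntegral_mul_sep (nonlin3 P R) (fun y => h y ^ 4), h4, Ihat_eq_of_Qhat hQ]
    rw [Qhat] at hQ
    linear_combination (-4 / 3 * κ) * hQ
  have hQ' : svirial (resc α (1 / (κ * Θ ^ 2)) (sepFun h P))
      (resc α (1 / (κ * Θ ^ 2)) (sepFun h R)) = 0 := by
    rw [svirial_eq, enX_resc hu.diff hv.diff α hβ, integral_nonlin_resc _ _ α hβ, ex, en,
      show α ^ 4 = (α ^ 2) ^ 2 by ring, hα]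
    field_simp
    ring
  refine ⟨_, _, (inS_iff hΘ).2 ⟨hu.resc α hβ, ?_⟩, (inS_iff hΘ).2 ⟨hv.resc α hβ, ?_⟩, hQ', ?_⟩
  · rw [integral_sq_resc _ α hβ, mass P hP1, hα]; field_simp
  · rw [integral_sq_resc _ α hβ, mass R hR1, hα]; field_simp
  · rw [energy_eq (hu.resc α hβ) (hv.resc α hβ) hQ', enX_resc hu.diff hv.diff α hβ,
      enY_resc hu.diff α hβ, enY_resc hv.diff α hβ, ex, ey P hP.diff hP1, ey R hR.diff hR1, hα]
    field_simp
    ring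

lemma mlevel_le_separable (hh : Differentiable ℝ h) (hh' : Continuous (deriv h))
    (hper : ∀ y, h (y + 2 * π) = h y) (h2 : ∫ y, h y ^ 2 ∂circ = 1) {κ : ℝ} (hκ : 0 < κ)
    (h4 : ∫ y, h y ^ 4 ∂circ = κ) {Θ : ℝ} (hΘ : 0 < Θ) :
    Θ ^ 2 * mlevel Θ ≤ mhat 1 / κ ^ 2 + Θ ^ 4 * ∫ y, deriv h y ^ 2 ∂circ := by
  have key : ∀ c, mhat 1 < c → (Θ ^ 2 * mlevel Θ - Θ ^ 4 * ∫ y, deriv h y ^ 2 ∂circ) * κ ^ 2 ≤ c := by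
    intro c hc
    obtain ⟨P, R, hP, hR, hP1, hR1, hQ, hlt⟩ := exists_Ihat_lt one_pos hc
    obtain ⟨u, v, hu, hv, hQ', he⟩ :=
      exists_separable_pair hh hh' hper h2 hκ h4 hP hR hP1 hR1 hQ hΘ
    have h1 := mlevel_le hu hv hQ'
    rw [he] at h1
    have h5 := mul_le_mul_of_nonneg_left h1 (by positivity : 0 ≤ Θ ^ 2 * κ ^ 2)
    have e : Θ ^ 2 * κ ^ 2 * (Ihat P R / (κ ^ 2 * Θ ^ 2) + Θ ^ 2 * ∫ y, deriv h y ^ 2 ∂circ)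
        = Ihat P R + Θ ^ 4 * κ ^ 2 * ∫ y, deriv h y ^ 2 ∂circ := by field_simp
    rw [e] at h5
    linarith
  have := le_of_forall_gt_imp_ge_of_dense key
  rw [← sub_le_iff_le_add, le_div_iff₀ (by positivity)]
  exact this

lemma constraint_nonempty {Θ : ℝ} (hΘ : 0 < Θ) :
    {c | ∃ u v : Pt → ℝ, inS Θ u ∧ inS Θ v ∧ svirial u v = 0 ∧ energy u v = c}.Nonempty := by
  obtain ⟨P, R, hP, hR, hP1, hR1, hQ, -⟩ := exists_Ihat_lt one_pos (lt_add_one (mhat 1))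
  have hc : ∀ n : ℕ, ∫ _ : ℝ, (1 / Real.sqrt (2 * π)) ^ n ∂circ
      = 2 * π * (1 / Real.sqrt (2 * π)) ^ n := fun n => by
    rw [integral_const, circ_real_univ, smul_eq_mul]
  obtain ⟨u, v, hu, hv, hQ', -⟩ := exists_separable_pair (h := fun _ => 1 / Real.sqrt (2 * π))
    (differentiable_const _) (by simp only [deriv_const']; exact continuous_const)
    (fun _ => rfl) (by rw [hc, div_pow, Real.sq_sqrt (by positivity)]; field_simp)
    (κ := 2 * π * (1 / Real.sqrt (2 * π)) ^ 4) (by positivity) (hc 4) hP hR hP1 hR1 hQ hΘ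
  exact ⟨_, u, v, hu, hv, hQ', rfl⟩

lemma mlevel_le_planar {Θ : ℝ} (hΘ : 0 < Θ) : Θ ^ 2 * mlevel Θ ≤ 4 * π ^ 2 * mhat 1 := by
  have hc : ∀ n : ℕ, ∫ _ : ℝ, (1 / Real.sqrt (2 * π)) ^ n ∂circ
      = 2 * π * (1 / Real.sqrt (2 * π)) ^ n := fun n => by
    rw [integral_const, circ_real_univ, smul_eq_mul]
  have hs : Real.sqrt (2 * π) ^ 2 = 2 * π := Real.sq_sqrt (by positivity)
  have h := mlevel_le_separable (h := fun _ => 1 / Real.sqrt (2 * π))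
    (differentiable_const _) (by simp only [deriv_const']; exact continuous_const)
    (fun _ => rfl) (by rw [hc, div_pow, hs]; field_simp)
    (κ := 1 / (2 * π)) (by positivity)
    (by rw [hc, div_pow, show Real.sqrt (2 * π) ^ 4 = (Real.sqrt (2 * π) ^ 2) ^ 2 by ring, hs]
        field_simp) hΘ
  simp only [deriv_const'] at h
  refine h.trans_eq ?_
  simp
  field_simp
  norm_num

lemma mlevel_le_cos {Θ : ℝ} (hΘ : 0 < Θ) :
    Θ ^ 2 * mlevel Θ ≤ 4 / 9 * (4 * π ^ 2 * mhat 1) + Θ ^ 4 := by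
  have hs : Real.sqrt π ^ 2 = π := Real.sq_sqrt (by positivity)
  have hcirc : ∀ f : ℝ → ℝ, ∫ y, f y ∂circ = ∫ y in (0 : ℝ)..2 * π, f y := fun f =>
    (intervalIntegral.integral_of_le (by positivity)).symm
  have hd : deriv (fun y => Real.cos y / Real.sqrt π) = fun y => -Real.sin y / Real.sqrt π := by
    ext y
    exact ((Real.hasDerivAt_cos y).div_const _).deriv
  have hc2 : ∫ y in (0 : ℝ)..2 * π, Real.cos y ^ 2 = π := by
    rw [integral_cos_sq]; simp
  have h := mlevel_le_separable (h := fun y => Real.cos y / Real.sqrt π)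
    (Real.differentiable_cos.div_const _) (by rw [hd]; fun_prop)
    (fun y => by rw [Real.cos_add_two_pi])
    (by simp only [div_pow, hs]
        rw [hcirc, intervalIntegral.integral_div, hc2, div_self Real.pi_ne_zero])
    (κ := 3 / (4 * π)) (by positivity)
    (by simp only [div_pow, show Real.sqrt π ^ 4 = (Real.sqrt π ^ 2) ^ 2 by ring, hs]
        rw [hcirc, intervalIntegral.integral_div, integral_cos_pow, hc2]
        simp
        field_simp
        norm_num) hΘ
  rw [hd] at h
  simp only [div_pow, neg_sq, hs] at h
  rw [hcirc, intervalIntegral.integral_div, integral_sin_sq] at h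
  refine h.trans_eq ?_
  simp
  field_simp
  ring

end Separable

section Threshold

variable {u v : Pt → ℝ} {Θ : ℝ}

lemma planar_level (hΘ : 0 < Θ) :
    2 * π * mhat (Θ / Real.sqrt (2 * π)) = 4 * π ^ 2 * mhat 1 / Θ ^ 2 := by
  rw [mhat_eq (by positivity), div_pow, Real.sq_sqrt (by positivity)]
  field_simp
  ring

lemma mul_mlevel_mono {Θ' : ℝ} (hΘ' : 0 < Θ') (h : Θ' ≤ Θ) :
    Θ' ^ 2 * mlevel Θ' ≤ Θ ^ 2 * mlevel Θ := by
  have hΘ : 0 < Θ := hΘ'.trans_le h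
  rw [← div_le_iff₀' (by positivity)]
  refine le_csInf (constraint_nonempty hΘ) ?_
  rintro c ⟨u, v, hu, hv, hQ, rfl⟩
  rw [div_le_iff₀' (by positivity), energy_eq hu.1 hv.1 hQ, mul_add]
  refine (mlevel_le_dilated hΘ' hΘ hu hv hQ).trans (add_le_add_right ?_ _)
  refine mul_le_mul_of_nonneg_right ?_
    (div_nonneg (add_nonneg (enY_nonneg u) (enY_nonneg v)) zero_le_two)
  rw [div_le_iff₀ (by positivity), ← pow_add]
  exact pow_le_pow_left₀ hΘ'.le h 4

lemma le_of_constraint {C : ℝ} (hC : ∀ u v, H1 u → H1 v →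
    ∫ z in Dom, u z ^ 2 = 1 → ∫ z in Dom, v z ^ 2 = 1 → svirial u v = 0 →
    6 * (4 * π ^ 2 * mhat 1) ≤ enX u v + C * (enY u + enY v)) (hΘ : 0 < Θ)
    (hu : inS Θ u) (hv : inS Θ v) (hQ : svirial u v = 0) :
    6 * (4 * π ^ 2 * mhat 1) ≤ Θ ^ 2 * enX u v + C * ((enY u + enY v) / Θ ^ 2) := by
  obtain ⟨p, q, hp, hq, hpq, h1, h2, h3⟩ := exists_dilated_pair one_pos hΘ hu hv hQ
  rw [inS_iff one_pos, one_pow] at hp hq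
  refine (hC p q hp.1 hq.1 hp.2 hq.2 hpq).trans_eq ?_
  rw [h1, h2, h3]
  ring

lemma enY_eq_zero_of_yindep (h : Yindep u) : enY u = 0 := by
  refine integral_eq_zero_of_ae ?_
  filter_upwards [ae_restrict_of_ae (s := Dom) h] with z hz
  simp [hz]

lemma H1.periodic_grady (hu : H1 u) : Function.Periodic (grady u) (0, 2 * π) := by
  intro z
  have e : (fun w : Pt => u (w + (0, 2 * π))) = u := by
    ext w
    have := hu.periodic w.1 w.2
    simpa [Prod.add_def] using this
  rw [grady, grady, ← fderiv_comp_add_right, e]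

lemma H1.yindep_of_enY_eq_zero (hu : H1 u) (h : enY u = 0) : Yindep u := by
  have h1 := (integral_eq_zero_iff_of_nonneg (fun _ => sq_nonneg _) hu.integrable_grady_sq).1 h
  have h2 : volume ({z : Pt | ¬ grady u z ^ 2 = 0} ∩ Dom) = 0 := by
    have hN : MeasurableSet {z : Pt | ¬ grady u z ^ 2 = 0} :=
      (measurableSet_eq_fun ((measurable_grady u).pow_const 2) measurable_const).compl
    rw [← Measure.restrict_apply hN]
    exact h1
  rw [Yindep, ae_iff]
  refine measure_mono_null (t := ⋃ n : ℤ, (fun z : Pt => z + n • ((0, 2 * π) : Pt)) ⁻¹'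
    ({z : Pt | ¬ grady u z ^ 2 = 0} ∩ Dom)) (fun z hz => ?_) ?_
  · obtain ⟨n, hn, -⟩ := existsUnique_add_zsmul_mem_Ioc Real.two_pi_pos z.2 0
    refine Set.mem_iUnion.2 ⟨n, ?_, ?_, ?_⟩
    · simpa only [Set.mem_ofPred_eq, hu.periodic_grady.zsmul n z, sq_eq_zero_iff] using hz
    · exact Set.mem_univ _
    · simpa using hn
  · refine measure_iUnion_null fun n => ?_
    have : (volume : Measure Pt).IsAddRightInvariant :=
      inferInstanceAs ((volume : Measure Pt3).prod (volume : Measure ℝ)).IsAddRightInvariant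
    rw [measure_preimage_add_right]
    exact h2

end Threshold

/-- there is a mass threshold `Θ₀` separating the regime where minimizers of
`m_Θ` depend on `y` (and `m_Θ < 2π m̂_{Θ/√(2π)}`) from the regime where they are
`y`-independent (and `m_Θ = 2π m̂_{Θ/√(2π)}`). -/
theorem mass_threshold_for_y_dependence :
    ∃ Θ₀ : ℝ, 0 < Θ₀ ∧
      (∀ Θ : ℝ, 0 < Θ → Θ < Θ₀ →
        mlevel Θ < 2 * π * mhat (Θ / Real.sqrt (2 * π)) ∧
        ∀ u v : Pt → ℝ, isMinimizer Θ u v → ¬ (Yindep u ∧ Yindep v)) ∧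
      (∀ Θ : ℝ, Θ₀ < Θ →
        mlevel Θ = 2 * π * mhat (Θ / Real.sqrt (2 * π)) ∧
        ∀ u v : Pt → ℝ, isMinimizer Θ u v → Yindep u ∧ Yindep v) := by
  obtain ⟨C, hC0, hC⟩ := exists_threshold_const
  have hm := mhat_one_pos
  have hπ := Real.pi_pos
  set T := 4 * π ^ 2 * mhat 1 with hTdef
  have hT : 0 < T := by positivity
  have hlarge : ∀ Θ : ℝ, C / 3 + 1 ≤ Θ → T ≤ Θ ^ 2 * mlevel Θ := fun Θ h => by
    have h1 : 1 ≤ Θ := by linarith [div_nonneg hC0 zero_le_three]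
    have hΘ : 0 < Θ := by linarith
    rw [← div_le_iff₀' (by positivity)]
    refine le_csInf (constraint_nonempty hΘ) ?_
    rintro c ⟨u, v, hu, hv, hQ, rfl⟩
    have hk := le_of_constraint hC hΘ hu hv hQ
    have hD := add_nonneg (enY_nonneg u) (enY_nonneg v)
    rw [div_le_iff₀' (by positivity), energy_eq hu.1 hv.1 hQ]
    have h2 : C * ((enY u + enY v) / Θ ^ 2) ≤ 3 * Θ ^ 2 * (enY u + enY v) := by
      rw [mul_div_assoc', div_le_iff₀ (by positivity), mul_right_comm]
      refine mul_le_mul_of_nonneg_right ?_ hD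
      have : Θ ≤ Θ ^ 4 := le_self_pow₀ h1 (by norm_num)
      nlinarith
    nlinarith
  set S := {Θ : ℝ | 0 < Θ ∧ Θ ^ 2 * mlevel Θ < T} with hS
  have hbdd : BddAbove S := ⟨C / 3 + 1, fun Θ h => by
    by_contra! hc
    exact absurd (hlarge Θ hc.le) (not_le.2 h.2)⟩
  have hne : min 1 (T / 2) ∈ S := by
    have h0 : 0 < min 1 (T / 2) := by positivity
    refine ⟨h0, (mlevel_le_cos h0).trans_lt ?_⟩
    have h4 : min 1 (T / 2) ^ 4 ≤ min 1 (T / 2) :=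
      pow_le_of_le_one h0.le (min_le_left _ _) (by norm_num)
    have := min_le_right 1 (T / 2)
    linarith
  have hpos : 0 < sSup S := hne.1.trans_le (le_csSup hbdd hne)
  refine ⟨sSup S, hpos, fun Θ hΘ hlt => ?_, fun Θ hlt => ?_⟩
  · obtain ⟨s, hs, hΘs⟩ := exists_lt_of_lt_csSup ⟨_, hne⟩ hlt
    have hf : mlevel Θ < T / Θ ^ 2 :=
      (lt_div_iff₀' (by positivity)).2 ((mul_mlevel_mono hΘ hΘs.le).trans_lt hs.2)
    refine ⟨by rwa [planar_level hΘ], ?_⟩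
    rintro u v ⟨hu, hv, hQ, he⟩ ⟨yu, yv⟩
    have hk := le_of_constraint hC hΘ hu hv hQ
    rw [energy_eq hu.1 hv.1 hQ, enY_eq_zero_of_yindep yu, enY_eq_zero_of_yindep yv] at he
    rw [enY_eq_zero_of_yindep yu, enY_eq_zero_of_yindep yv] at hk
    rw [← he, lt_div_iff₀' (by positivity)] at hf
    simp only [add_zero, zero_div, mul_zero] at hk hf
    linarith
  · have hval : ∀ s, sSup S < s → s ^ 2 * mlevel s = T := fun s hs => by
      have hs0 : 0 < s := hpos.trans hs
      refine (mlevel_le_planar hs0).antisymm ?_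
      by_contra! hc
      exact absurd (le_csSup hbdd (show s ∈ S from ⟨hs0, hc⟩)) (not_le.2 hs)
    have hΘ : 0 < Θ := hpos.trans hlt
    refine ⟨by rw [planar_level hΘ, eq_div_iff (by positivity), mul_comm]; exact hval Θ hlt, ?_⟩
    rintro u v ⟨hu, hv, hQ, he⟩
    obtain ⟨s, hs, hsΘ⟩ := exists_between hlt
    have hs0 : 0 < s := hpos.trans hs
    have h1 := mlevel_le_dilated hs0 hΘ hu hv hQ
    have h2 := hval Θ hlt
    rw [hval s hs] at h1
    rw [← he, energy_eq hu.1 hv.1 hQ] at h2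
    have h3 : s ^ 4 / Θ ^ 2 < Θ ^ 2 := by
      rw [div_lt_iff₀ (by positivity), ← pow_add]
      exact pow_lt_pow_left₀ hsΘ hs0.le (by norm_num)
    have du := enY_nonneg u
    have dv := enY_nonneg v
    have h4 : enY u + enY v ≤ 0 := by
      by_contra! hc
      nlinarith [mul_pos (sub_pos.2 h3) hc]
    exact ⟨hu.1.yindep_of_enY_eq_zero (by linarith), hv.1.yindep_of_enY_eq_zero (by linarith)⟩

end Waveguide
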